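/- arXiv:nlin/0701001 — 5 statements merged into one kernel-verified Lean document; each statement's English description precedes it below -/
import Mathlib

section
/- (Bilinear equation bl2.) Suppose ψ satisfies the contiguous relations (re1)–(re4), and fix nonzero t, b₁, b₃ ∈ ℂ such that qʲ·b₁ ≠ 1, qʲ·t·b₁ ≠ 1 and qʲ·b₃ ≠ 1 for every integer j. Then for every integer N ≥ 0: q·t·b₃·(1 − q^{−N}·b₁)·τ_N^{0,1}(t)·τ_{N+1}^{−1,1}(qt) + q^{−N}·τ_N^{−1,1}(qt)·τ_{N+1}^{0,1}(t) − τ_N^{−1,2}(qt)·τ_{N+1}^{0,0}(t) = 0. -/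
/-- `τ_N(t,b₁,b₃) = det(ψ(t, q^{1-j} b₁, q^{i-1} b₃))_{i,j=1,…,N}` (and `τ₀ = 1`,
which is the determinant of the empty matrix). -/
noncomputable def tau (q : ℂ) (ψ : ℂ → ℂ → ℂ → ℂ) (N : ℕ) (t b1 b3 : ℂ) : ℂ :=
  Matrix.det (Matrix.of fun i j : Fin N => ψ t (q ^ (-(j : ℤ)) * b1) (q ^ (i : ℤ) * b3))

/-- `τ_N^{m,n}(t) = τ_N(t, qᵐ b₁, qⁿ b₃)`. -/
noncomputable def tauS (q : ℂ) (ψ : ℂ → ℂ → ℂ → ℂ) (N : ℕ) (m n : ℤ) (t b1 b3 : ℂ) : ℂ :=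
  tau q ψ N t (q ^ m * b1) (q ^ n * b3)

noncomputable def DD (k : ℕ) (r : ℕ → ℕ → ℂ) : ℂ :=
  Matrix.det (Matrix.of fun i j : Fin k => r i j)

def cs (h : ℕ → ℂ) (g : ℕ → ℕ → ℂ) : ℕ → ℕ → ℂ
  | 0 => h
  | i + 1 => g i

lemma DD_congr (k : ℕ) (r s : ℕ → ℕ → ℂ) (h : ∀ i < k, ∀ j < k, r i j = s i j) :
    DD k r = DD k s := by
  unfold DD
  congr 1
  ext i j
  exact h i i.2 j j.2

lemma DD_top (k : ℕ) (f : ℕ → ℕ → ℂ) :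
    DD (k+1) f = DD (k+1) (cs (f 0) (fun i j => f (i+1) j - f i j)) := by
  unfold DD
  refine Matrix.det_eq_of_forall_row_eq_smul_add_pred (fun _ => 1) ?_ ?_
  · intro j; simp [cs]
  · intro i j; simp [cs]

lemma DD_cyc (k : ℕ) (u : ℕ → ℕ → ℂ) :
    DD (k+1) u = (-1)^k * DD (k+1) (cs (u k) u) := by
  unfold DD
  have := Matrix.det_permute (finRotate (k+1))
    (Matrix.of fun i j : Fin (k+1) => cs (u k) u i j)
  rw [sign_finRotate] at this
  push_cast at this
  rw [← this]
  congr 1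
  ext i j
  simp only [Matrix.of_apply, Matrix.submatrix_apply, id]
  induction i using Fin.lastCases with
  | last => simp [cs]
  | cast i => simp [cs]

lemma DD_exp (k : ℕ) (w : ℕ → ℕ → ℂ) :
    ∃ κ : Fin (k+1) → ℂ, ∀ v : ℕ → ℂ, DD (k+1) (cs v w) = ∑ j, κ j * v j := by
  refine ⟨fun j => (-1) ^ (j : ℕ) *
    Matrix.det (Matrix.of fun (a b : Fin k) => w a (j.succAbove b)), fun v => ?_⟩
  unfold DD
  rw [Matrix.det_succ_row_zero]
  refine Finset.sum_congr rfl fun j _ => ?_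
  have : (Matrix.of fun i j : Fin (k+1) => cs v w i j).submatrix Fin.succ j.succAbove
      = Matrix.of fun (a b : Fin k) => w a (j.succAbove b) := by
    ext a b; simp [cs]
  rw [this]
  simp [cs]; ring

lemma DD_exp' (k : ℕ) (w : ℕ → ℕ → ℂ) :
    ∃ κ : Fin (k+2) → ℂ, ∀ v : ℕ → ℂ, DD (k+1) (cs v w) = ∑ j, κ j * v j := by
  obtain ⟨κ, hκ⟩ := DD_exp k w
  refine ⟨Fin.snoc κ 0, fun v => ?_⟩
  rw [hκ, Fin.sum_univ_castSucc (n := k+1)]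
  simp

lemma cramer_row (k : ℕ) (g : ℕ → ℕ → ℂ) (h : ℕ → ℂ) (j : Fin k) :
    DD k g * h j = ∑ i : Fin k, DD k (Function.update g i h) * g i j := by
  have := congrFun (Matrix.mulVec_cramer (Matrix.of fun i j : Fin k => g i j).transpose
    (fun j : Fin k => h j)) j
  simp only [Matrix.mulVec, dotProduct, Matrix.cramer_transpose_apply, Matrix.det_transpose,
    Pi.smul_apply, smul_eq_mul, Matrix.transpose_apply, Matrix.of_apply] at this
  unfold DD
  rw [← this]
  refine Finset.sum_congr rfl fun i _ => ?_
  rw [mul_comm]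
  congr 2
  ext a b
  by_cases hab : a = i
  · subst hab; simp
  · have : (a : ℕ) ≠ i := fun h => hab (Fin.ext h)
    simp [Matrix.updateRow_ne hab, Function.update_of_ne this]

lemma DD_zero (k : ℕ) (w : ℕ → ℕ → ℂ) (i : ℕ) (hi : i < k) :
    DD (k+1) (cs (w i) w) = 0 := by
  unfold DD
  refine Matrix.det_zero_of_row_eq (i := 0) (j := (⟨i, hi⟩ : Fin k).succ)
    (Fin.succ_ne_zero _).symm ?_
  ext b
  simp [cs]

lemma plucker (n : ℕ) (g : ℕ → ℕ → ℂ) (h : ℕ → ℂ) :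
    DD (n+2) g * DD (n+1) (cs h (fun i => g (i+1))) =
      DD (n+2) (cs h (fun i => g (i+1))) * DD (n+1) g
        - DD (n+2) (cs h g) * DD (n+1) (fun i => g (i+1)) := by
  obtain ⟨κ, hκ⟩ := DD_exp' n (fun i => g (i+1))
  have key : DD (n+2) g * DD (n+1) (cs h (fun i => g (i+1))) =
      ∑ i : Fin (n+2), DD (n+2) (Function.update g i h) *
        DD (n+1) (cs (g i) (fun i => g (i+1))) := by
    simp only [hκ, Finset.mul_sum]
    rw [Finset.sum_comm]
    refine Finset.sum_congr rfl fun j _ => ?_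
    rw [mul_left_comm, cramer_row, Finset.mul_sum]
    refine Finset.sum_congr rfl fun i _ => ?_
    ring
  rw [key, Fin.sum_univ_succ, Fin.sum_univ_castSucc, Finset.sum_eq_zero]
  · have e1 : DD (n+2) (Function.update g 0 h) = DD (n+2) (cs h (fun i => g (i+1))) := by
      apply DD_congr
      intro i _ j _
      cases i <;> simp [cs]
    have e2 : DD (n+1) (cs (g 0) (fun i => g (i+1))) = DD (n+1) g := by
      apply DD_congr
      intro i _ j _
      cases i <;> simp [cs]
    have e3 : DD (n+2) (Function.update g (n+1) h) = (-1)^(n+1) * DD (n+2) (cs h g) := by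
      rw [DD_cyc]
      congr 1
      apply DD_congr
      intro i hi j _
      cases i with
      | zero => simp [cs]
      | succ i =>
        have : i ≠ n + 1 := by omega
        simp [cs, Function.update_of_ne this]
    have e4 := DD_cyc n (fun i => g (i+1))
    have e5 : ((-1 : ℂ)^n) * (-1)^n = 1 := by rw [← mul_pow]; simp
    simp only [Fin.val_zero, Fin.succ_last, Fin.val_last, e1, e2, e3, e4]
    ring
  · intro i _
    have := DD_zero n (fun i => g (i+1)) i i.2
    simp only [Fin.val_succ, Fin.val_castSucc]
    rw [this, mul_zero]

lemma DD_scale (k : ℕ) (c d : ℕ → ℂ) (G : ℕ → ℕ → ℂ) :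
    DD k (fun i j => c i * d j * G i j) =
      (∏ i ∈ Finset.range k, c i) * (∏ i ∈ Finset.range k, d i) * DD k G := by
  unfold DD
  have h1 := Matrix.det_mul_column (fun i : Fin k => c i)
    (Matrix.of fun i j : Fin k => d j * G i j)
  have h2 := Matrix.det_mul_row (fun i : Fin k => d i) (Matrix.of fun i j : Fin k => G i j)
  simp only [Matrix.of_apply] at h1 h2
  rw [Finset.prod_range, Finset.prod_range, mul_assoc, ← h2, ← h1]
  congr 1
  ext i j
  simp [mul_assoc]

lemma abstract_bl (N : ℕ) (q c0 : ℂ) (hq : q ≠ 0) (hc : c0 ≠ 0) (d : ℕ → ℂ) (hd : ∀ j, d j ≠ 0)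
    (f G : ℕ → ℕ → ℂ) (hR : ∀ i j, f i j - f (i+1) j = c0 * q ^ i * d j * G i j) :
    c0 * d N * DD N (fun i => f (i+1)) * DD (N+1) G
      + (q ^ N)⁻¹ * DD N G * DD (N+1) (fun i => f (i+1))
      - DD N (fun i => G (i+1)) * DD (N+1) f = 0 := by
  cases N with
  | zero =>
    have := hR 0 0
    simp [DD] at this ⊢
    linear_combination -this
  | succ n =>
    have P := plucker n (fun i j => f (i+1) j - f i j) (f 1)
    have t1 := DD_top n (fun i => f (i+1))
    have t2 := DD_top (n+1) (fun i => f (i+1))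
    have t3 : DD (n+2) (cs (f 1) (fun i j => f (i+1) j - f i j)) = DD (n+2) f := by
      rw [DD_top (n+1) f]
      unfold DD
      refine Matrix.det_eq_of_forall_row_eq_smul_add_const
        (Function.update 0 0 1) 1 ?_ ?_
      · simp
      · intro i j
        cases i using Fin.cases with
        | zero => simp [cs]
        | succ i => simp [cs]
    simp only [zero_add] at t1 t2
    rw [← t1, ← t2, t3] at P
    have E : (fun i j => f (i+1) j - f i j) = fun i j => (-c0 * q^i) * d j * G i j := by
      funext i j
      linear_combination - hR i j
    have E' : (fun i j => f (i+1+1) j - f (i+1) j)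
        = fun i j => (-c0 * q^i * q) * d j * G (i+1) j := by
      funext i j
      have := hR (i+1) j
      rw [pow_succ] at this
      linear_combination - this
    rw [E, E', DD_scale, DD_scale (n+1) _ d G,
      DD_scale (n+1) (fun i => -c0 * q^i * q) d (fun i => G (i+1)),
      Finset.prod_range_succ _ (n+1), Finset.prod_range_succ _ (n+1),
      Finset.prod_mul_distrib (g := fun _ => q), Finset.prod_const, Finset.card_range] at P
    have hA : (∏ i ∈ Finset.range (n+1), (-c0 * q^i)) ≠ 0 :=
      Finset.prod_ne_zero_iff.2 fun i _ => mul_ne_zero (neg_ne_zero.2 hc) (pow_ne_zero _ hq)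
    have hB : (∏ i ∈ Finset.range (n+1), d i) ≠ 0 :=
      Finset.prod_ne_zero_iff.2 fun i _ => hd i
    have hQ : q ^ (n+1) ≠ 0 := pow_ne_zero _ hq
    generalize (∏ i ∈ Finset.range (n+1), (-c0 * q^i)) = A at *
    generalize (∏ i ∈ Finset.range (n+1), d i) = B at *
    apply mul_left_cancel₀ (mul_ne_zero hQ (mul_ne_zero hA hB))
    generalize q ^ (n+1) = Q at *
    have hi : Q * Q⁻¹ = 1 := mul_inv_cancel₀ hQ
    linear_combination -P + (A * B * DD (n+1) G * DD (n+1+1) (fun i => f (i+1))) * hi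

theorem bilinear_bl2 (q : ℂ) (hq : q ≠ 0) (ψ : ℂ → ℂ → ℂ → ℂ)
    (hre1 : ∀ t b1 b3 : ℂ, t ≠ 0 → b1 ≠ 0 → b3 ≠ 0 →
      ψ (q * t) b1 b3 = b1 * ψ t b1 b3 + (1 - b1) * ψ (q * t) (b1 / q) b3)
    (hre2 : ∀ t b1 b3 : ℂ, t ≠ 0 → b1 ≠ 0 → b3 ≠ 0 →
      b3 * ψ (q * t) b1 b3 = ψ t b1 b3 + (b3 - 1) * ψ t b1 (q * b3))
    (hre3 : ∀ t b1 b3 : ℂ, t ≠ 0 → b1 ≠ 0 → b3 ≠ 0 →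
      q * t * b1 * b3 * ψ (q * t) b1 b3 = (q * t * b1 - 1) * ψ t b1 b3 + ψ t (q * b1) b3)
    (hre4 : ∀ t b1 b3 : ℂ, t ≠ 0 → b1 ≠ 0 → b3 ≠ 0 →
      q * t * ψ (q * t) b1 b3 = (q * t * b1 - 1) * ψ t b1 b3 + ψ (q * t) b1 (b3 / q))
    (t b1 b3 : ℂ) (ht : t ≠ 0) (hb1 : b1 ≠ 0) (hb3 : b3 ≠ 0)
    (hgen1 : ∀ j : ℤ, q ^ j * b1 ≠ 1)
    (hgen2 : ∀ j : ℤ, q ^ j * t * b1 ≠ 1)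
    (hgen3 : ∀ j : ℤ, q ^ j * b3 ≠ 1) :
    ∀ N : ℕ,
      q * t * b3 * (1 - q ^ (-(N : ℤ)) * b1) * tauS q ψ N 0 1 t b1 b3 * tauS q ψ (N + 1) (-1) 1 (q * t) b1 b3
        + q ^ (-(N : ℤ)) * tauS q ψ N (-1) 1 (q * t) b1 b3 * tauS q ψ (N + 1) 0 1 t b1 b3
        - tauS q ψ N (-1) 2 (q * t) b1 b3 * tauS q ψ (N + 1) 0 0 t b1 b3 = 0 := by
  intro N
  have hz : ∀ k : ℤ, q ^ k ≠ 0 := fun k => zpow_ne_zero k hq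
  have key := abstract_bl N q (q * t * b3) hq (mul_ne_zero (mul_ne_zero hq ht) hb3)
    (fun j => 1 - q ^ (-(j : ℤ)) * b1) (fun j => sub_ne_zero.2 (hgen1 _).symm)
    (fun i j => ψ t (q ^ (-(j : ℤ)) * b1) (q ^ (i : ℤ) * b3))
    (fun i j => ψ (q * t) (q ^ (-(j : ℤ)) * b1 / q) (q * (q ^ (i : ℤ) * b3))) (by
      intro i j
      have hB1 : q ^ (-(j : ℤ)) * b1 ≠ 0 := mul_ne_zero (hz _) hb1
      have hB3 : q ^ (i : ℤ) * b3 ≠ 0 := mul_ne_zero (hz _) hb3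
      have e : q ^ ((i + 1 : ℕ) : ℤ) * b3 = q * (q ^ (i : ℤ) * b3) := by
        push_cast; rw [zpow_add₀ hq, zpow_one]; ring
      have e2 : q * t * b3 * q ^ i = q * t * (q ^ (i : ℤ) * b3) := by
        rw [zpow_natCast]; ring
      simp only [e, e2]
      generalize q ^ (-(j : ℤ)) * b1 = x at *
      generalize q ^ (i : ℤ) * b3 = y at *
      have r1 := hre1 t x (q * y) ht hB1 (mul_ne_zero hq hB3)
      have r2 := hre2 t x y ht hB1 hB3
      have r4 := hre4 t x (q * y) ht hB1 (mul_ne_zero hq hB3)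
      rw [mul_div_cancel_left₀ _ hq] at r4
      linear_combination (q * t * y) * r1 - r2 - y * r4)
  have a1 : ∀ k : ℕ, ∀ n : ℕ, ∀ s : ℂ, tauS q ψ k 0 n s b1 b3 =
      DD k (fun i j => ψ s (q ^ (-(j : ℤ)) * b1) (q ^ ((i + n : ℕ) : ℤ) * b3)) := by
    intro k n s
    unfold tauS tau DD
    congr 1; ext i j
    simp only [Matrix.of_apply]
    push_cast
    rw [zpow_add₀ hq]
    simp [mul_assoc]
  have a2 : ∀ k : ℕ, ∀ n : ℕ, ∀ s : ℂ, tauS q ψ k (-1) ((n + 1 : ℕ) : ℤ) s b1 b3 =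
      DD k (fun i j => ψ s (q ^ (-(j : ℤ)) * b1 / q) (q * (q ^ ((i + n : ℕ) : ℤ) * b3))) := by
    intro k n s
    unfold tauS tau DD
    congr 1; ext i j
    simp only [Matrix.of_apply]
    push_cast
    rw [zpow_add₀ hq, zpow_add₀ hq, zpow_one, zpow_neg_one]
    congr 1 <;> ring
  have b1' := a1 N 1 t
  have b2' := a1 (N+1) 1 t
  have b3' := a1 (N+1) 0 t
  have c1' := a2 (N+1) 0 (q * t)
  have c2' := a2 N 0 (q * t)
  have c3' := a2 N 1 (q * t)
  simp only [Nat.cast_one, Nat.cast_zero, zero_add, add_zero] at b1' b2' b3' c1' c2' c3'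
  rw [show ((1 + 1 : ℕ) : ℤ) = 2 from rfl] at c3'
  rw [b1', b2', b3', c1', c2', c3', zpow_neg, zpow_natCast]
  rw [zpow_neg, zpow_natCast] at key
  exact key
end

section
/- (Bilinear equation bl3.) Suppose ψ satisfies the contiguous relations (re1)–(re4), and fix nonzero t, b₁, b₃ ∈ ℂ such that qʲ·b₁ ≠ 1, qʲ·t·b₁ ≠ 1 and qʲ·b₃ ≠ 1 for every integer j. Then for every integer N ≥ 0: q·t·(1 − q^{−N}·b₁)·τ_N^{0,1}(t)·τ_{N+1}^{−1,1}(qt) + q^{−N}·τ_N^{−1,1}(qt)·τ_{N+1}^{0,1}(t) − q^{−N}·τ_N^{−1,2}(t)·τ_{N+1}^{0,0}(qt) = 0. -/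
/-- Determinant of the first `n` vectors of a sequence. -/
noncomputable def seqDet (n : ℕ) (f : ℕ → Fin n → ℂ) : ℂ :=
  Matrix.det (Matrix.of fun i j : Fin n => f i j)

theorem seqDet_of_update (n : ℕ) (f : ℕ → Fin n → ℂ) (k : ℕ) (hk : k < n) (v : Fin n → ℂ) :
    seqDet n (Function.update f k v)
      = ((Matrix.of fun i j : Fin n => f i j).updateRow ⟨k, hk⟩ v).det := by
  unfold seqDet
  congr 1
  ext i j
  by_cases h : i = ⟨k, hk⟩
  · subst h; simp
  · have h' : (i : ℕ) ≠ k := fun h2 => h (Fin.ext h2)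
    simp [Matrix.updateRow_ne h, Function.update_of_ne h']

theorem seqDet_congr (n : ℕ) (f g : ℕ → Fin n → ℂ) (h : ∀ i < n, f i = g i) :
    seqDet n f = seqDet n g := by
  unfold seqDet
  congr 1
  ext i j
  simp [h i i.2]

theorem seqDet_zero_of_eq (n : ℕ) (f : ℕ → Fin n → ℂ) (a b : ℕ) (ha : a < n) (hb : b < n)
    (hab : a ≠ b) (h : f a = f b) : seqDet n f = 0 := by
  unfold seqDet
  apply Matrix.det_zero_of_row_eq (i := ⟨a, ha⟩) (j := ⟨b, hb⟩)
  · intro h2; exact hab (by simpa using h2)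
  · ext j; simp [h]

theorem plucker_s8 (k : ℕ) (x : ℕ → Fin (k+2) → ℂ) (z e : Fin (k+2) → ℂ) :
    seqDet (k+2) (Function.update x (k+1) z) *
        seqDet (k+2) (Function.update (fun i => x (i+1)) (k+1) e)
      = seqDet (k+2) x *
          seqDet (k+2) (Function.update (Function.update (fun i => x (i+1)) k z) (k+1) e)
        + seqDet (k+2) (Function.update (fun i => x (i+1)) (k+1) z) *
          seqDet (k+2) (Function.update x (k+1) e) := by
  set xs : ℕ → Fin (k+2) → ℂ := fun i => x (i+1) with hxs
  set f := Function.update xs (k+1) z with hf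
  set A : Matrix (Fin (k+2)) (Fin (k+2)) ℂ := Matrix.of fun i j => f i j with hA
  set B : Matrix (Fin (k+2)) (Fin (k+2)) ℂ := Matrix.of fun i j => x i j with hB
  have hl : ∀ v, Matrix.cramer B.transpose v (Fin.last (k+1))
      = seqDet (k+2) (Function.update x (k+1) v) := by
    intro v
    rw [Matrix.cramer_transpose_apply, seqDet_of_update _ _ _ (by omega)]
    rfl
  have hc : ∀ i : Fin (k+2), Matrix.cramer A.transpose e i
      = seqDet (k+2) (Function.update f i e) := by
    intro i
    rw [Matrix.cramer_transpose_apply, seqDet_of_update _ _ _ i.2]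
  have key : A.det • e = ∑ i : Fin (k+2), seqDet (k+2) (Function.update f i e) • f i := by
    have h := Matrix.mulVec_cramer A.transpose e
    rw [Matrix.det_transpose] at h
    rw [← h]
    ext j
    simp only [Matrix.mulVec, dotProduct, Matrix.transpose_apply, Finset.sum_apply, Pi.smul_apply,
      smul_eq_mul, hc]
    apply Finset.sum_congr rfl
    intro i _
    rw [mul_comm]; rfl
  have key2 := congrArg (fun v => Matrix.cramer B.transpose v (Fin.last (k+1))) key
  simp only [map_smul, map_sum, Pi.smul_apply, Finset.sum_apply, smul_eq_mul] at key2
  simp only [hl] at key2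
  rw [Fin.sum_univ_castSucc, Fin.sum_univ_castSucc, Finset.sum_eq_zero] at key2
  · simp only [Fin.val_castSucc, Fin.val_last, zero_add] at key2
    have e1 : f k = x (k+1) := by
      rw [hf, Function.update_of_ne (by omega)]
    have e2 : f (k+1) = z := by simp [hf]
    have e3 : Function.update f (k+1) e = Function.update xs (k+1) e := by simp [hf]
    rw [e1, e2, e3, Function.update_eq_self] at key2
    have e4 : seqDet (k+2) (Function.update f k e)
        = - seqDet (k+2) (Function.update (Function.update xs k z) (k+1) e) := by
      unfold seqDet
      have h := Matrix.det_permute (Equiv.swap (⟨k, by omega⟩ : Fin (k+2)) ⟨k+1, by omega⟩)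
        (Matrix.of fun i j : Fin (k+2) => Function.update (Function.update xs k z) (k+1) e i j)
      rw [Equiv.Perm.sign_swap (by simp)] at h
      simp only [Units.val_neg, Units.val_one, Int.cast_neg, Int.cast_one, neg_mul, one_mul] at h
      rw [← h]
      congr 1
      ext i j
      simp only [Matrix.of_apply, Matrix.submatrix_apply, id]
      by_cases h1 : i = ⟨k, by omega⟩
      · subst h1; simp
      · by_cases h2 : i = ⟨k+1, by omega⟩
        · subst h2; simp [hf]
        · rw [Equiv.swap_apply_of_ne_of_ne h1 h2]
          have h1' : (i : ℕ) ≠ k := fun h => h1 (Fin.ext h)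
          have h2' : (i : ℕ) ≠ k+1 := fun h => h2 (Fin.ext h)
          simp [hf, Function.update_of_ne h1', Function.update_of_ne h2']
    rw [e4] at key2
    have e5 : seqDet (k+2) f = A.det := rfl
    rw [e5]
    linear_combination -key2
  · intro i _
    have : seqDet (k+2) (Function.update x (k+1) (f (i.castSucc.castSucc : Fin (k+2)))) = 0 := by
      have hi := i.2
      apply seqDet_zero_of_eq _ _ (i+1) (k+1) (by omega) (by omega) (by omega)
      rw [Function.update_of_ne (by omega), Function.update_self]
      simp only [Fin.val_castSucc]
      rw [hf, Function.update_of_ne (by omega)]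
    rw [this, mul_zero]

theorem seqDet_elim (n : ℕ) (x y : ℕ → Fin n → ℂ) (κ : ℕ → ℂ) (M : ℕ) (hM : M < n)
    (h : ∀ j < M, y j = x j + κ j • y (j+1)) :
    seqDet n y = seqDet n (fun i => if i < M then x i else y i) := by
  induction M with
  | zero => simp
  | succ M ih =>
    rw [ih (by omega) (fun j hj => h j (by omega))]
    set g : ℕ → Fin n → ℂ := fun i => if i < M + 1 then x i else y i with hg
    have h1 : (fun i => if i < M then x i else y i) = Function.update g M (g M + κ M • g (M+1)) := by
      funext i
      by_cases hi : i = M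
      · subst hi; simp [hg, h]
      · rw [Function.update_of_ne hi]
        simp only [hg]
        have : i < M ↔ i < M + 1 := by omega
        simp [this]
    rw [h1, seqDet_of_update _ _ _ (by omega)]
    have := Matrix.det_updateRow_add_smul_self (Matrix.of fun i j : Fin n => g i j)
      (i := ⟨M, by omega⟩) (j := ⟨M+1, hM⟩) (by simp) (κ M)
    exact this

theorem bilin (N : ℕ) (x y : ℕ → Fin (N+1) → ℂ) (κ : ℕ → ℂ)
    (h : ∀ j ≤ N, y j = x j + κ j • y (j+1)) (e : Fin (N+1) → ℂ) :
    seqDet (N+1) y * seqDet (N+1) (Function.update (fun i => x (i+1)) N e)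
      = seqDet (N+1) x * seqDet (N+1) (Function.update (fun i => y (i+1)) N e)
        + κ N * seqDet (N+1) (fun i => y (i+1)) * seqDet (N+1) (Function.update x N e) := by
  have s1 : seqDet (N+1) y = seqDet (N+1) (Function.update x N (y N)) := by
    rw [seqDet_elim (N+1) x y κ N (by omega) (fun j hj => h j hj.le)]
    apply seqDet_congr
    intro i hi
    by_cases h2 : i = N
    · subst h2; simp
    · rw [Function.update_of_ne h2, if_pos (by omega)]
  have s2 : κ N * seqDet (N+1) (fun i => y (i+1))
      = seqDet (N+1) (Function.update (fun i => x (i+1)) N (κ N • y (N+1))) := by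
    rw [seqDet_elim (N+1) (fun i => x (i+1)) (fun i => y (i+1)) (fun i => κ (i+1)) N (by omega)
      (fun j hj => h (j+1) hj)]
    rw [seqDet_of_update _ _ _ (by omega), Matrix.det_updateRow_smul,
      ← seqDet_of_update (N+1) (fun i => x (i+1)) N (by omega)]
    congr 1
    apply seqDet_congr
    intro i hi
    by_cases h2 : i = N
    · subst h2; simp
    · rw [Function.update_of_ne h2, if_pos (by omega)]
  rcases N with _ | k
  · rw [s2, s1, h 0 le_rfl]
    simp [seqDet]
    ring
  · have s3 : seqDet (k+2) (Function.update (fun i => x (i+1)) (k+1) (κ (k+1) • y (k+2)))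
        = seqDet (k+2) (Function.update (fun i => x (i+1)) (k+1) (y (k+1))) := by
      have hz : seqDet (k+2) (Function.update (fun i => x (i+1)) (k+1) (x (k+1))) = 0 := by
        apply seqDet_zero_of_eq _ _ k (k+1) (by omega) (by omega) (by omega)
        simp
      rw [h (k+1) le_rfl]
      rw [seqDet_of_update _ _ _ (by omega)] at hz ⊢
      rw [seqDet_of_update _ _ _ (by omega), Matrix.det_updateRow_add, hz, zero_add]
    have s4 : seqDet (k+2) (Function.update (fun i => y (i+1)) (k+1) e)
        = seqDet (k+2) (Function.update (Function.update (fun i => x (i+1)) k (y (k+1))) (k+1) e) := by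
      rw [seqDet_elim (k+2) (fun i => x (i+1)) (Function.update (fun i => y (i+1)) (k+1) e)
        (fun i => κ (i+1)) k (by omega)]
      · apply seqDet_congr
        intro i hi
        by_cases h2 : i = k+1
        · subst h2; simp
        · rw [Function.update_of_ne h2, Function.update_of_ne h2]
          by_cases h3 : i = k
          · subst h3; simp
          · rw [Function.update_of_ne h3, if_pos (by omega)]
      · intro j hj
        rw [Function.update_of_ne (by omega), Function.update_of_ne (by omega)]
        exact h (j+1) (by omega)
    rw [s2, s1, s3, s4]
    exact plucker_s8 k x (y (k+1)) e

theorem seqDet_single (N : ℕ) (f : ℕ → Fin (N+1) → ℂ) (c : Fin (N+1)) :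
    seqDet (N+1) (Function.update f N (Pi.single c 1))
      = (-1) ^ (N + (c : ℕ)) * Matrix.det (Matrix.of fun i j : Fin N => f i (c.succAbove j)) := by
  unfold seqDet
  rw [Matrix.det_succ_row _ (Fin.last N), Finset.sum_eq_single c]
  · simp only [Fin.val_last, Matrix.of_apply, Function.update_self, Pi.single_eq_same, mul_one]
    congr 2
    ext i j
    have := i.2
    simp [Function.update_of_ne (by omega : (i : ℕ) ≠ N)]
  · intro b _ hb
    simp [Pi.single_eq_of_ne hb]
  · simp

theorem R1 (q : ℂ) (hq : q ≠ 0) (ψ : ℂ → ℂ → ℂ → ℂ)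
    (hre1 : ∀ t b1 b3 : ℂ, t ≠ 0 → b1 ≠ 0 → b3 ≠ 0 →
      ψ (q * t) b1 b3 = b1 * ψ t b1 b3 + (1 - b1) * ψ (q * t) (b1 / q) b3)
    (t b1 b3 : ℂ) (ht : t ≠ 0) (hb1 : b1 ≠ 0) (hb3 : b3 ≠ 0) (N : ℕ) :
    q ^ (-(N : ℤ)) * tau q ψ (N+1) (q*t) b1 b3 * tau q ψ N t (q ^ (-1 : ℤ) * b1) b3
      = q ^ (-(N : ℤ)) * b1 * tau q ψ (N+1) t b1 b3 * tau q ψ N (q*t) (q ^ (-1 : ℤ) * b1) b3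
        + (1 - q ^ (-(N : ℤ)) * b1) * tau q ψ (N+1) (q*t) (q ^ (-1 : ℤ) * b1) b3
          * tau q ψ N t b1 b3 := by
  have hs : ∀ j : ℕ, q ^ (-((j+1 : ℕ) : ℤ)) * b1 = q ^ (-(j : ℤ)) * (q ^ (-1 : ℤ) * b1) := by
    intro j
    rw [← mul_assoc, ← zpow_add₀ hq]; congr 2; push_cast; ring
  have H := bilin N
    (fun j i => (q ^ (-(j : ℤ)) * b1) * ψ t (q ^ (-(j : ℤ)) * b1) (q ^ ((i : ℕ) : ℤ) * b3))
    (fun j i => ψ (q*t) (q ^ (-(j : ℤ)) * b1) (q ^ ((i : ℕ) : ℤ) * b3))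
    (fun j => 1 - q ^ (-(j : ℤ)) * b1)
    (by
      intro j _
      funext i
      simp only [Pi.add_apply, Pi.smul_apply, smul_eq_mul]
      rw [hre1 t _ _ ht (mul_ne_zero (zpow_ne_zero _ hq) hb1) (mul_ne_zero (zpow_ne_zero _ hq) hb3)]
      congr 3
      rw [hs, div_eq_mul_inv, zpow_neg_one]; ring)
    (Pi.single (Fin.last N) 1)
  simp only [seqDet_single, hs, Fin.succAbove_last, Fin.val_castSucc, Fin.val_last] at H
  have hT : ∀ (n : ℕ) (T c : ℂ), Matrix.det (Matrix.of fun j i : Fin n =>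
      ψ T (q ^ (-((j : ℕ) : ℤ)) * c) (q ^ ((i : ℕ) : ℤ) * b3)) = tau q ψ n T c b3 := by
    intro n T c
    unfold tau
    rw [← Matrix.det_transpose]
    rfl
  have hX : ∀ (n : ℕ) (T c : ℂ), Matrix.det (Matrix.of fun j i : Fin n =>
      (q ^ (-((j : ℕ) : ℤ)) * c) * ψ T (q ^ (-((j : ℕ) : ℤ)) * c) (q ^ ((i : ℕ) : ℤ) * b3))
        = (∏ j : Fin n, (q ^ (-((j : ℕ) : ℤ)) * c)) * tau q ψ n T c b3 := by
    intro n T c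
    rw [← hT, ← Matrix.det_mul_column]
    rfl
  simp only [seqDet, hT, hX, Fin.prod_univ_castSucc, Fin.val_castSucc, Fin.val_last] at H
  have hP : (∏ j : Fin N, (q ^ (-((j : ℕ) : ℤ)) * (q ^ (-1 : ℤ) * b1)))
      = q ^ (-(N : ℤ)) * ∏ j : Fin N, (q ^ (-((j : ℕ) : ℤ)) * b1) := by
    have : ∀ j : Fin N, q ^ (-((j : ℕ) : ℤ)) * (q ^ (-1 : ℤ) * b1)
      = q ^ (-1 : ℤ) * (q ^ (-((j : ℕ) : ℤ)) * b1) := fun j => by ring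
    simp only [this, Finset.prod_mul_distrib (f := fun _ => q ^ (-1 : ℤ)), Finset.prod_const,
      Finset.card_univ, Fintype.card_fin]
    congr 1
    rw [← zpow_natCast, ← zpow_mul]; congr 1; ring
  rw [hP] at H
  have hP0 : (∏ j : Fin N, (q ^ (-((j : ℕ) : ℤ)) * b1)) ≠ 0 :=
    Finset.prod_ne_zero_iff.mpr fun j _ => mul_ne_zero (zpow_ne_zero _ hq) hb1
  have hsg : ((-1 : ℂ)) ^ (N + N) ≠ 0 := pow_ne_zero _ (by norm_num)
  apply mul_left_cancel₀ (mul_ne_zero hP0 hsg)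
  linear_combination H

theorem R4 (q : ℂ) (hq : q ≠ 0) (ψ : ℂ → ℂ → ℂ → ℂ)
    (hre4 : ∀ t b1 b3 : ℂ, t ≠ 0 → b1 ≠ 0 → b3 ≠ 0 →
      q * t * ψ (q * t) b1 b3 = (q * t * b1 - 1) * ψ t b1 b3 + ψ (q * t) b1 (b3 / q))
    (t b1 b3 : ℂ) (ht : t ≠ 0) (hb1 : b1 ≠ 0) (hb3 : b3 ≠ 0)
    (hgen2 : ∀ j : ℤ, q ^ j * t * b1 ≠ 1) (N : ℕ) :
    tau q ψ (N+1) (q*t) b1 b3 * tau q ψ N t (q ^ (-1 : ℤ) * b1) (q * (q * b3))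
      = (1 - q * t * b1) * tau q ψ (N+1) t b1 (q * b3)
          * tau q ψ N (q*t) (q ^ (-1 : ℤ) * b1) (q * b3)
        + q * t * tau q ψ (N+1) (q*t) b1 (q * b3)
          * tau q ψ N t (q ^ (-1 : ℤ) * b1) (q * b3) := by
  have hs : ∀ j : ℕ, q ^ (-((j+1 : ℕ) : ℤ)) * b1 = q ^ (-(j : ℤ)) * (q ^ (-1 : ℤ) * b1) := by
    intro j
    rw [← mul_assoc, ← zpow_add₀ hq]; congr 2; push_cast; ring
  have hn : ∀ (j : ℕ) (c : ℂ), q ^ ((j+1 : ℕ) : ℤ) * c = q ^ (j : ℤ) * (q * c) := by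
    intro j c
    push_cast
    rw [zpow_add_one₀ hq]; ring
  have H := bilin N
    (fun n j => (1 - q * t * (q ^ (-((j : ℕ) : ℤ)) * b1)) *
      ψ t (q ^ (-((j : ℕ) : ℤ)) * b1) (q ^ (n : ℤ) * (q * b3)))
    (fun n j => ψ (q*t) (q ^ (-((j : ℕ) : ℤ)) * b1) (q ^ (n : ℤ) * b3))
    (fun _ => q * t)
    (by
      intro n _
      funext j
      simp only [Pi.add_apply, Pi.smul_apply, smul_eq_mul]
      rw [hn, hre4 t _ _ ht (mul_ne_zero (zpow_ne_zero _ hq) hb1)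
        (mul_ne_zero (zpow_ne_zero _ hq) (mul_ne_zero hq hb3))]
      have : q ^ (n : ℤ) * (q * b3) / q = q ^ (n : ℤ) * b3 := by field_simp
      rw [this]; ring)
    (Pi.single 0 1)
  simp only [seqDet_single, hn, Fin.succAbove_zero, Fin.val_succ, Fin.val_zero, hs] at H
  have hT : ∀ (n : ℕ) (T c d : ℂ), Matrix.det (Matrix.of fun i j : Fin n =>
      ψ T (q ^ (-((j : ℕ) : ℤ)) * c) (q ^ ((i : ℕ) : ℤ) * d)) = tau q ψ n T c d := by
    intro n T c d
    rfl
  have hX : ∀ (n : ℕ) (T c d : ℂ), Matrix.det (Matrix.of fun i j : Fin n =>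
      (1 - q * t * (q ^ (-((j : ℕ) : ℤ)) * c)) *
        ψ T (q ^ (-((j : ℕ) : ℤ)) * c) (q ^ ((i : ℕ) : ℤ) * d))
        = (∏ j : Fin n, (1 - q * t * (q ^ (-((j : ℕ) : ℤ)) * c))) * tau q ψ n T c d := by
    intro n T c d
    rw [← hT, ← Matrix.det_mul_row]
    rfl
  simp only [seqDet, hT, hX, Fin.prod_univ_succ, Fin.val_succ, Fin.val_zero, hs] at H
  have hP0 : (∏ j : Fin N, (1 - q * t * (q ^ (-((j : ℕ) : ℤ)) * (q ^ (-1 : ℤ) * b1)))) ≠ 0 := by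
    refine Finset.prod_ne_zero_iff.mpr fun j _ => ?_
    intro h
    apply hgen2 (-((j : ℕ) : ℤ))
    rw [zpow_neg_one] at h
    have : q * t * (q ^ (-((j : ℕ) : ℤ)) * (q⁻¹ * b1)) = q ^ (-((j : ℕ) : ℤ)) * t * b1 := by
      field_simp
    rw [this] at h
    linear_combination -h
  have hsg : ((-1 : ℂ)) ^ (N + 0) ≠ 0 := pow_ne_zero _ (by norm_num)
  simp only [Nat.cast_zero, neg_zero, zpow_zero, one_mul] at H
  apply mul_left_cancel₀ (mul_ne_zero hP0 hsg)
  linear_combination H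

theorem bilinear_bl3 (q : ℂ) (hq : q ≠ 0) (ψ : ℂ → ℂ → ℂ → ℂ)
    (hre1 : ∀ t b1 b3 : ℂ, t ≠ 0 → b1 ≠ 0 → b3 ≠ 0 →
      ψ (q * t) b1 b3 = b1 * ψ t b1 b3 + (1 - b1) * ψ (q * t) (b1 / q) b3)
    (hre2 : ∀ t b1 b3 : ℂ, t ≠ 0 → b1 ≠ 0 → b3 ≠ 0 →
      b3 * ψ (q * t) b1 b3 = ψ t b1 b3 + (b3 - 1) * ψ t b1 (q * b3))
    (hre3 : ∀ t b1 b3 : ℂ, t ≠ 0 → b1 ≠ 0 → b3 ≠ 0 →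
      q * t * b1 * b3 * ψ (q * t) b1 b3 = (q * t * b1 - 1) * ψ t b1 b3 + ψ t (q * b1) b3)
    (hre4 : ∀ t b1 b3 : ℂ, t ≠ 0 → b1 ≠ 0 → b3 ≠ 0 →
      q * t * ψ (q * t) b1 b3 = (q * t * b1 - 1) * ψ t b1 b3 + ψ (q * t) b1 (b3 / q))
    (t b1 b3 : ℂ) (ht : t ≠ 0) (hb1 : b1 ≠ 0) (hb3 : b3 ≠ 0)
    (hgen1 : ∀ j : ℤ, q ^ j * b1 ≠ 1)
    (hgen2 : ∀ j : ℤ, q ^ j * t * b1 ≠ 1)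
    (hgen3 : ∀ j : ℤ, q ^ j * b3 ≠ 1) :
    ∀ N : ℕ,
      q * t * (1 - q ^ (-(N : ℤ)) * b1) * tauS q ψ N 0 1 t b1 b3 * tauS q ψ (N + 1) (-1) 1 (q * t) b1 b3
        + q ^ (-(N : ℤ)) * tauS q ψ N (-1) 1 (q * t) b1 b3 * tauS q ψ (N + 1) 0 1 t b1 b3
        - q ^ (-(N : ℤ)) * tauS q ψ N (-1) 2 t b1 b3 * tauS q ψ (N + 1) 0 0 (q * t) b1 b3 = 0 := by
  intro N
  have hqb : q * b3 ≠ 0 := mul_ne_zero hq hb3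
  have h1 := R1 q hq ψ hre1 t b1 (q * b3) ht hb1 hqb N
  have h4 := R4 q hq ψ hre4 t b1 b3 ht hb1 hb3 hgen2 N
  have e2 : q ^ (2 : ℤ) * b3 = q * (q * b3) := by
    rw [zpow_ofNat]; ring
  simp only [tauS, zpow_zero, one_mul, zpow_one, e2]
  linear_combination -(q * t) * h1 - q ^ (-(N : ℤ)) * h4
end

section
/- (Bilinear equation bl4.) Suppose ψ satisfies the contiguous relations (re1)–(re4), and fix nonzero t, b₁, b₃ ∈ ℂ such that qʲ·b₁ ≠ 1, qʲ·t·b₁ ≠ 1 and qʲ·b₃ ≠ 1 for every integer j. Then for every integer N ≥ 0: q^{−N}·τ_N^{−1,1}(t)·τ_{N+1}^{0,1}(t) − q^{−N}·b₁·τ_N^{−1,2}(t)·τ_{N+1}^{0,0}(t) − (1 − q^{−N}·b₁)·(1 − q^{−N}·t·b₁)·τ_N^{0,1}(t)·τ_{N+1}^{−1,1}(t) = 0. -/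
open Matrix in
/-- Three-term Plücker relation. -/
lemma aux_plucker {n : ℕ} (S : Fin n → Fin (n + 2) → ℂ) (a b c d : Fin (n + 2) → ℂ) :
    let br : (Fin (n + 2) → ℂ) → (Fin (n + 2) → ℂ) → ℂ := fun u v =>
      det (Matrix.of (Fin.cons u (Fin.cons v S : Fin (n + 1) → Fin (n + 2) → ℂ) :
        Fin (n + 2) → Fin (n + 2) → ℂ))
    br a b * br c d = br c b * br a d + br a c * br b d := by
  intro br
  set A : Matrix (Fin (n + 2)) (Fin (n + 2)) ℂ := Matrix.of (Fin.cons a (Fin.cons b S : Fin (n + 1) → Fin (n + 2) → ℂ)) with hA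
  set M : Matrix (Fin (n + 2)) (Fin (n + 2)) ℂ := Matrix.of (Fin.cons 0 (Fin.cons d S : Fin (n + 1) → Fin (n + 2) → ℂ)) with hM
  let φ : (Fin (n + 2) → ℂ) →ₗ[ℂ] ℂ := (LinearMap.proj 0).comp (cramer Mᵀ)
  have hφ : ∀ v, φ v = br v d := by
    intro v
    simp only [φ, br, LinearMap.comp_apply, LinearMap.proj_apply, cramer_transpose_apply]
    congr 1
    ext i j
    refine Fin.cases ?_ (fun i => ?_) i
    · simp [Matrix.updateRow_apply]
    · simp [Matrix.updateRow_apply, hM]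
  have h1 : Aᵀ *ᵥ cramer Aᵀ c = A.det • c := by rw [mulVec_cramer, det_transpose]
  have h2 : Aᵀ *ᵥ cramer Aᵀ c = ∑ i, (cramer Aᵀ c i) • A i := by
    ext k
    simp [Matrix.mulVec, dotProduct, Finset.sum_apply, mul_comm]
  have h3 := congrArg φ (h2.symm.trans h1)
  rw [map_sum, Fin.sum_univ_succ, Fin.sum_univ_succ] at h3
  simp only [LinearMap.map_smul, smul_eq_mul] at h3
  simp only [hφ] at h3
  have hz : ∀ i : Fin n, br (A i.succ.succ) d = 0 := by
    intro i
    apply det_zero_of_row_eq (i := 0) (j := i.succ.succ)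
    · exact (Fin.succ_ne_zero _).symm
    · ext k; simp [hA]
  have e0 : cramer Aᵀ c 0 = br c b := by
    rw [cramer_transpose_apply]
    simp only [br]
    congr 1
    ext i j
    refine Fin.cases ?_ (fun i => ?_) i
    · simp [Matrix.updateRow_apply]
    · simp [Matrix.updateRow_apply, hA]
  have e1 : cramer Aᵀ c (Fin.succ 0) = br a c := by
    rw [cramer_transpose_apply]
    simp only [br]
    congr 1
    ext i j
    refine Fin.cases ?_ (fun i => ?_) i
    · simp [Matrix.updateRow_apply, hA, Fin.ext_iff]
    · refine Fin.cases ?_ (fun i => ?_) i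
      · simp [Matrix.updateRow_apply]
      · simp [Matrix.updateRow_apply, hA, Fin.ext_iff]
  simp only [hz, mul_zero, Finset.sum_const_zero, add_zero, e0, e1] at h3
  have a0 : A 0 = a := by ext; simp [hA]
  have a1 : A (Fin.succ 0) = b := by ext; simp [hA]
  rw [a0, a1] at h3
  exact h3.symm

open Matrix in
lemma aux_swap {n : ℕ} (S : Fin n → Fin (n + 2) → ℂ) (u v : Fin (n + 2) → ℂ) :
    det (Matrix.of (Fin.cons u (Fin.cons v S : Fin (n + 1) → Fin (n + 2) → ℂ) :
        Fin (n + 2) → Fin (n + 2) → ℂ)) =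
    - det (Matrix.of (Fin.cons v (Fin.cons u S : Fin (n + 1) → Fin (n + 2) → ℂ) :
        Fin (n + 2) → Fin (n + 2) → ℂ)) := by
  have h := det_permute (Equiv.swap (0 : Fin (n + 2)) 1) (Matrix.of (Fin.cons v (Fin.cons u S : Fin (n + 1) → Fin (n + 2) → ℂ) :
        Fin (n + 2) → Fin (n + 2) → ℂ))
  rw [Equiv.Perm.sign_swap (by simp)] at h
  have h' : (Matrix.of (Fin.cons u (Fin.cons v S : Fin (n + 1) → Fin (n + 2) → ℂ) :
        Fin (n + 2) → Fin (n + 2) → ℂ)) = (Matrix.of (Fin.cons v (Fin.cons u S : Fin (n + 1) → Fin (n + 2) → ℂ) :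
        Fin (n + 2) → Fin (n + 2) → ℂ)).submatrix (Equiv.swap (0 : Fin (n + 2)) 1) id := by
    ext i j
    refine Fin.cases ?_ (fun i => ?_) i
    · simp only [Matrix.submatrix_apply, Equiv.swap_apply_left, Matrix.of_apply]
      rfl
    · refine Fin.cases ?_ (fun i => ?_) i
      · have : (Fin.succ (0 : Fin (n + 1))) = 1 := rfl
        rw [this]
        simp only [Matrix.submatrix_apply, Equiv.swap_apply_right, Matrix.of_apply]
        rfl
      · simp only [Matrix.submatrix_apply, Matrix.of_apply]
        rw [Equiv.swap_apply_of_ne_of_ne]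
        · simp
        · exact Fin.succ_ne_zero _
        · simp [Fin.ext_iff]
  rw [h', h]
  simp

open Matrix in
lemma aux_cycle {m : ℕ} (w : Fin (m + 1) → Fin (m + 1) → ℂ) :
    det (Matrix.of (Fin.cons (w (Fin.last m)) (fun i : Fin m => w i.castSucc) :
        Fin (m + 1) → Fin (m + 1) → ℂ)) = (-1) ^ m * det (Matrix.of w) := by
  have h := det_permute (finRotate (m + 1)) (Matrix.of (Fin.cons (w (Fin.last m)) (fun i : Fin m => w i.castSucc) :
        Fin (m + 1) → Fin (m + 1) → ℂ))
  have h' : (Matrix.of (Fin.cons (w (Fin.last m)) (fun i : Fin m => w i.castSucc) :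
        Fin (m + 1) → Fin (m + 1) → ℂ)).submatrix (finRotate (m + 1)) id = Matrix.of w := by
    ext i j
    refine Fin.lastCases ?_ (fun i => ?_) i
    · simp
    · simp [Fin.coeSucc_eq_succ]
  rw [h', sign_finRotate] at h
  rw [h]
  push_cast
  rw [← mul_assoc, ← mul_pow]
  simp

open Matrix in
lemma aux_single {m : ℕ} (w : Fin m → Fin (m + 1) → ℂ) :
    det (Matrix.of (Fin.cons (Pi.single 0 1) w :
        Fin (m + 1) → Fin (m + 1) → ℂ)) = det (Matrix.of fun i j : Fin m => w i j.succ) := by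
  rw [det_succ_row_zero, Fin.sum_univ_succ]
  simp
  rfl

open Matrix in
lemma aux_chain {n : ℕ} (G H : ℕ → Fin (n + 1) → ℂ) (x c : ℕ → ℂ) (hc : ∀ j, c j ≠ 0)
    (h : ∀ j i, G j i - x j * H j i = c j * G (j + 1) i) :
    (∏ j ∈ Finset.range n, c j) * det (Matrix.of fun j i : Fin (n + 1) => G j i) =
    (∏ j ∈ Finset.range n, (- x j)) * det (Matrix.of (Fin.cons (G 0) (fun j : Fin n => H j) :
      Fin (n + 1) → Fin (n + 1) → ℂ)) := by
  let P : ℕ → ℂ := fun j => ∏ k ∈ Finset.range j, c k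
  have hP : ∀ j, P j ≠ 0 := fun j => Finset.prod_ne_zero_iff.mpr fun k _ => hc k
  have hPs : ∀ j, P (j + 1) = P j * c j := fun j => Finset.prod_range_succ _ _
  let v : Fin (n + 1) → ℂ := Fin.cons 1 (fun j : Fin n => - x j * P j)
  have key := det_eq_of_forall_row_eq_smul_add_pred
    (A := Matrix.of fun j i : Fin (n + 1) => P j * G j i)
    (B := Matrix.of fun j i : Fin (n + 1) => v j * (Matrix.of (Fin.cons (G 0) (fun j : Fin n => H j) :
      Fin (n + 1) → Fin (n + 1) → ℂ)) j i) (fun _ => 1)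
    (by intro j; simp [P, v])
    (by
      intro i j
      simp only [Matrix.of_apply, v, Fin.cons_succ, Fin.val_succ, Fin.val_castSucc, hPs, mul_assoc,
        ← h]
      ring)
  rw [det_mul_column] at key
  have k2 := det_mul_column (fun j : Fin (n + 1) => P j) (Matrix.of fun j i : Fin (n + 1) => G j i)
  simp only [Matrix.of_apply] at k2
  rw [k2, Fin.prod_univ_castSucc, Fin.prod_univ_succ] at key
  simp only [v, Fin.cons_succ, Fin.cons_zero, one_mul, Finset.prod_mul_distrib, Fin.val_castSucc,
    Fin.val_last] at key
  have hne : (∏ j : Fin n, P j) ≠ 0 := Finset.prod_ne_zero_iff.mpr fun k _ => hP k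
  rw [← Fin.prod_univ_eq_prod_range (fun j => -x j)]
  apply mul_left_cancel₀ hne
  linear_combination key

open Matrix in
lemma aux_main (F : ℕ → ℕ → ℂ) (x c : ℕ → ℂ) (hc : ∀ j, c j ≠ 0) (hx : ∀ j, x j ≠ 0)
    (h : ∀ j i, F (i + 1) j - x j * F i j = c j * F (i + 1) (j + 1)) (n : ℕ) :
    let T : ℕ → ℕ → ℕ → ℂ := fun N r s => det (Matrix.of fun j i : Fin N => F (i + r) (j + s))
    x (n + 1) * (T (n + 1) 1 1 * T (n + 2) 1 0) - x 0 * x (n + 1) * (T (n + 1) 2 1 * T (n + 2) 0 0)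
      = x 0 * c (n + 1) * (T (n + 1) 1 0 * T (n + 2) 1 1) := by
  intro T
  let V : ℕ → ℕ → Fin (n + 2) → ℂ := fun r j i => F (i + r) j
  let S : Fin n → Fin (n + 2) → ℂ := fun j => V 0 (j + 1)
  let Z := V 0 (n + 1)
  let Y := V 0 0
  let U := V 1 1
  let e : Fin (n + 2) → ℂ := Pi.single 0 1
  let br : (Fin (n + 2) → ℂ) → (Fin (n + 2) → ℂ) → ℂ := fun u v =>
      det (Matrix.of (Fin.cons u (Fin.cons v S : Fin (n + 1) → Fin (n + 2) → ℂ) :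
        Fin (n + 2) → Fin (n + 2) → ℂ))
  have pl : br Z e * br U Y = br U e * br Z Y + br Z U * br e Y := aux_plucker S Z e U Y
  have sw1 : br Z e = - br e Z := aux_swap S Z e
  have sw2 : br U e = - br e U := aux_swap S U e
  -- e Z
  have eZ : br e Z = (-1) ^ n * T (n + 1) 1 1 := by
    simp only [br, e]
    rw [aux_single]
    have := aux_cycle (fun (j i : Fin (n + 1)) => F (i + 1) (j + 1))
    rw [← this]
    congr 1
    ext j i
    refine Fin.cases ?_ (fun j => ?_) j <;> simp [S, Z, V]
  have eY : br e Y = T (n + 1) 1 0 := by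
    simp only [br, e, T]
    rw [aux_single]
    congr 1
    ext j i
    refine Fin.cases ?_ (fun j => ?_) j <;> simp [S, Y, V]
  have ZY : br Z Y = (-1) ^ (n + 1) * T (n + 2) 0 0 := by
    simp only [br, T]
    have := aux_cycle (fun (j i : Fin (n + 2)) => F (i + 0) (j + 0))
    rw [← this]
    congr 1
    ext j i
    refine Fin.cases ?_ (fun j => ?_) j
    · simp [Z, V]
    · refine Fin.cases ?_ (fun j => ?_) j <;> simp [S, Y, V]
  set C := ∏ j ∈ Finset.range n, c (j + 1) with hC
  set X := ∏ j ∈ Finset.range n, (- x (j + 1)) with hX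
  have C0 : C ≠ 0 := Finset.prod_ne_zero_iff.mpr fun k _ => hc _
  have X0 : X ≠ 0 := Finset.prod_ne_zero_iff.mpr fun k _ => neg_ne_zero.mpr (hx _)
  have eU : C * T (n + 1) 2 1 = X * br e U := by
    have := aux_chain (n := n) (fun j i => F (i + 2) (j + 1)) (fun j i => F (i + 1) (j + 1))
      (fun j => x (j + 1)) (fun j => c (j + 1)) (fun j => hc _) (fun j i => h (j + 1) (i + 1))
    simp only [T]
    rw [this]
    simp only [br, e]
    rw [aux_single]
    congr 2
    ext j i
    refine Fin.cases ?_ (fun j => ?_) j <;> simp [S, U, V] <;> rfl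
  have ZU : C * c (n + 1) * T (n + 2) 1 1 = X * (- x (n + 1)) * ((-1) ^ (n + 1) * br Z U) := by
    have := aux_chain (n := n + 1) (fun j i => F (i + 1) (j + 1)) (fun j i => F i (j + 1))
      (fun j => x (j + 1)) (fun j => c (j + 1)) (fun j => hc _) (fun j i => h (j + 1) i)
    rw [Finset.prod_range_succ, Finset.prod_range_succ] at this
    simp only [T]
    rw [this]
    congr 1
    let w : Fin (n + 2) → Fin (n + 2) → ℂ := Fin.cons (fun i => F (i + 1) (0 + 1)) (fun j : Fin (n + 1) => fun i => F i (j + 1))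
    have h2 := aux_cycle w
    have h3 : br Z U = (-1) ^ (n + 1) * det (Matrix.of w) := by
      rw [← h2]
      simp only [br]
      congr 1
      ext j i
      refine Fin.cases ?_ (fun j => ?_) j
      · simp [Z, V, w, ← Fin.succ_last]
      · refine Fin.cases ?_ (fun j => ?_) j
        · simp [U, V, w]
        · simp [S, V, w, ← Fin.succ_castSucc]
    rw [h3, ← mul_assoc, ← mul_pow]
    simp [w]
  have UY : C * T (n + 2) 1 0 = X * (- x 0) * br U Y := by
    have := aux_chain (n := n + 1) (fun j i => F (i + 1) j) (fun j i => F i j)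
      x c hc (fun j i => h j i)
    rw [Finset.prod_range_succ', Finset.prod_range_succ'] at this
    apply mul_left_cancel₀ (hc 0)
    have h4 : det (Matrix.of (Fin.cons (fun i : Fin (n + 2) => F (i + 1) 0)
        (fun (j : Fin (n + 1)) (i : Fin (n + 2)) => F i j) : Fin (n + 2) → Fin (n + 2) → ℂ)) = c 0 * br U Y := by
      set A : Matrix (Fin (n + 2)) (Fin (n + 2)) ℂ := Matrix.of (Fin.cons U (Fin.cons Y S : Fin (n + 1) → Fin (n + 2) → ℂ) :
        Fin (n + 2) → Fin (n + 2) → ℂ) with hA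
      have b : br U Y = A.det := rfl
      have h5 := det_updateRow_smul A 0 (c 0) U
      have h6 : A.updateRow 0 U = A := by
        ext j i
        refine Fin.cases ?_ (fun j => ?_) j <;> simp [hA, Matrix.updateRow_apply]
      rw [h6] at h5
      rw [b, ← h5, ← det_updateRow_add_smul_self (A.updateRow 0 (c 0 • U)) (i := 0) (j := Fin.succ 0) (Fin.succ_ne_zero _).symm (x 0)]
      congr 1
      ext j i
      refine Fin.cases ?_ (fun j => ?_) j
      · have := h 0 i
        simp [hA, U, Y, V, Matrix.updateRow_apply]
        linear_combination this
      · refine Fin.cases ?_ (fun j => ?_) j <;> simp [hA, Y, S, V, Matrix.updateRow_apply]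
    rw [h4] at this
    simp only [T]
    simp only [add_zero] at this ⊢
    linear_combination this
  have hs : ((-1 : ℂ) ^ n) * (-1) ^ n = 1 := by rw [← mul_pow]; simp
  rw [sw1, sw2, eZ, ZY, eY] at pl
  rw [pow_succ] at pl ZU
  apply mul_left_cancel₀ C0
  set σ := (-1 : ℂ) ^ n
  have pl' : T (n + 1) 1 1 * br U Y + br e U * T (n + 2) 0 0 + σ * br Z U * T (n + 1) 1 0 = 0 := by
    linear_combination (-σ) * pl - (T (n + 1) 1 1 * br U Y + br e U * T (n + 2) 0 0) * hs
  linear_combination x (n + 1) * T (n + 1) 1 1 * UY - x 0 * x (n + 1) * T (n + 2) 0 0 * eU - x 0 * T (n + 1) 1 0 * ZU - X * x 0 * x (n + 1) * pl'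

theorem bilinear_bl4 (q : ℂ) (hq : q ≠ 0) (ψ : ℂ → ℂ → ℂ → ℂ)
    (hre1 : ∀ t b1 b3 : ℂ, t ≠ 0 → b1 ≠ 0 → b3 ≠ 0 →
      ψ (q * t) b1 b3 = b1 * ψ t b1 b3 + (1 - b1) * ψ (q * t) (b1 / q) b3)
    (hre2 : ∀ t b1 b3 : ℂ, t ≠ 0 → b1 ≠ 0 → b3 ≠ 0 →
      b3 * ψ (q * t) b1 b3 = ψ t b1 b3 + (b3 - 1) * ψ t b1 (q * b3))
    (hre3 : ∀ t b1 b3 : ℂ, t ≠ 0 → b1 ≠ 0 → b3 ≠ 0 →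
      q * t * b1 * b3 * ψ (q * t) b1 b3 = (q * t * b1 - 1) * ψ t b1 b3 + ψ t (q * b1) b3)
    (hre4 : ∀ t b1 b3 : ℂ, t ≠ 0 → b1 ≠ 0 → b3 ≠ 0 →
      q * t * ψ (q * t) b1 b3 = (q * t * b1 - 1) * ψ t b1 b3 + ψ (q * t) b1 (b3 / q))
    (t b1 b3 : ℂ) (ht : t ≠ 0) (hb1 : b1 ≠ 0) (hb3 : b3 ≠ 0)
    (hgen1 : ∀ j : ℤ, q ^ j * b1 ≠ 1)
    (hgen2 : ∀ j : ℤ, q ^ j * t * b1 ≠ 1)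
    (hgen3 : ∀ j : ℤ, q ^ j * b3 ≠ 1) :
    ∀ N : ℕ,
      q ^ (-(N : ℤ)) * tauS q ψ N (-1) 1 t b1 b3 * tauS q ψ (N + 1) 0 1 t b1 b3
        - q ^ (-(N : ℤ)) * b1 * tauS q ψ N (-1) 2 t b1 b3 * tauS q ψ (N + 1) 0 0 t b1 b3
        - (1 - q ^ (-(N : ℤ)) * b1) * (1 - q ^ (-(N : ℤ)) * t * b1)
            * tauS q ψ N 0 1 t b1 b3 * tauS q ψ (N + 1) (-1) 1 t b1 b3 = 0 := by
  have hA : ∀ u v : ℂ, u ≠ 0 → v ≠ 0 →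
      ψ t u (q * v) - u * ψ t u v = (1 - u) * (1 - t * u) * ψ t (u / q) (q * v) := by
    intro u v hu hv
    have hqv : q * v ≠ 0 := mul_ne_zero hq hv
    have r1 := hre1 t u (q * v) ht hu hqv
    have r2 := hre2 t u v ht hu hv
    have r3 := hre3 t (u / q) (q * v) ht (div_ne_zero hu hq) hqv
    have r4 := hre4 t u (q * v) ht hu hqv
    have e1 : q * (u / q) = u := by field_simp
    have e2 : q * v / q = v := by field_simp
    have e3 : q * t * (u / q) = t * u := by field_simp
    rw [e3, e1] at r3
    rw [e2] at r4
    linear_combination u * v * r4 + u * r2 - (1 - u) * r3 - t * u * q * v * r1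
  let F : ℕ → ℕ → ℂ := fun i j => ψ t (q ^ (-(j : ℤ)) * b1) (q ^ (i : ℤ) * b3)
  let x : ℕ → ℂ := fun j => q ^ (-(j : ℤ)) * b1
  let c : ℕ → ℂ := fun j => (1 - x j) * (1 - t * x j)
  have hx : ∀ j, x j ≠ 0 := fun j => mul_ne_zero (zpow_ne_zero _ hq) hb1
  have hc : ∀ j, c j ≠ 0 := by
    intro j
    apply mul_ne_zero
    · exact sub_ne_zero.mpr (hgen1 _).symm
    · refine sub_ne_zero.mpr fun h => hgen2 (-(j : ℤ)) ?_
      rw [h]; simp only [x]; ring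
  have hF : ∀ j i, F (i + 1) j - x j * F i j = c j * F (i + 1) (j + 1) := by
    intro j i
    have := hA (x j) (q ^ (i : ℤ) * b3) (hx j) (mul_ne_zero (zpow_ne_zero _ hq) hb3)
    have e1 : q * (q ^ (i : ℤ) * b3) = q ^ ((i + 1 : ℕ) : ℤ) * b3 := by
      push_cast; rw [zpow_add₀ hq]; simp; ring
    have e2 : x j / q = q ^ (-((j + 1 : ℕ) : ℤ)) * b1 := by
      simp only [x]; push_cast; rw [neg_add, zpow_add₀ hq]; simp; field_simp
    rw [e1, e2] at this
    exact this
  let T : ℕ → ℕ → ℕ → ℂ := fun N r s => Matrix.det (Matrix.of fun j i : Fin N => F (i + r) (j + s))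
  have hT : ∀ N r s : ℕ, tauS q ψ N (-(s : ℤ)) r t b1 b3 = T N r s := by
    intro N r s
    simp only [tauS, tau, T]
    rw [← Matrix.det_transpose]
    congr 1
    ext j i
    simp only [Matrix.transpose_apply, Matrix.of_apply, F]
    push_cast
    rw [neg_add, zpow_add₀ hq, zpow_add₀ hq, mul_assoc, mul_assoc]
  intro N
  have t1 := hT N 1 1
  have t2 := hT (N + 1) 1 0
  have t3 := hT N 2 1
  have t4 := hT (N + 1) 0 0
  have t5 := hT N 1 0
  have t6 := hT (N + 1) 1 1
  push_cast at t1 t2 t3 t4 t5 t6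
  rw [neg_zero] at t2 t4 t5
  rw [t1, t2, t3, t4, t5, t6]
  rcases N with _ | n
  · have := hF 0 0
    simp [T, c, x] at this ⊢
    linear_combination this
  · have := aux_main F x c hc hx hF n
    have hx0 : x 0 = b1 := by simp [x]
    simp only [hx0] at this
    apply mul_left_cancel₀ hb1
    have hxn : x (n + 1) = q ^ (-((n + 1 : ℕ) : ℤ)) * b1 := rfl
    have hcn : c (n + 1) = (1 - q ^ (-((n + 1 : ℕ) : ℤ)) * b1) * (1 - q ^ (-((n + 1 : ℕ) : ℤ)) * t * b1) := by
      simp only [c, hxn]; ring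
    rw [hxn, hcn] at this
    simp only [T]
    linear_combination this
end

section
/- (Bilinear equation bl5.) Suppose ψ satisfies the contiguous relations (re1)–(re4), and fix nonzero t, b₁, b₃ ∈ ℂ such that qʲ·b₁ ≠ 1, qʲ·t·b₁ ≠ 1 and qʲ·b₃ ≠ 1 for every integer j. Then for every integer N ≥ 0: q^{−N}·τ_N^{−1,1}(t)·τ_{N+1}^{0,1}(t) − τ_N^{−1,2}(t)·τ_{N+1}^{0,0}(t) + q^{N+1}·t·b₃·(1 − q^{−N}·b₁)·τ_N^{0,1}(t/q)·τ_{N+1}^{−1,1}(qt) = 0. -/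
theorem bl5_plucker {N : ℕ} (W : Fin N → Fin (N+2) → ℂ) (a b c d : Fin (N+2) → ℂ) :
    Matrix.det (Matrix.of (Fin.cons b (Fin.cons c W) : Fin (N+2) → Fin (N+2) → ℂ)) *
      Matrix.det (Matrix.of (Fin.cons a (Fin.cons d W) : Fin (N+2) → Fin (N+2) → ℂ)) =
    Matrix.det (Matrix.of (Fin.cons d (Fin.cons c W) : Fin (N+2) → Fin (N+2) → ℂ)) *
      Matrix.det (Matrix.of (Fin.cons a (Fin.cons b W) : Fin (N+2) → Fin (N+2) → ℂ)) +
    Matrix.det (Matrix.of (Fin.cons b (Fin.cons d W) : Fin (N+2) → Fin (N+2) → ℂ)) *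
      Matrix.det (Matrix.of (Fin.cons a (Fin.cons c W) : Fin (N+2) → Fin (N+2) → ℂ)) := by
  set A : Matrix (Fin (N+2)) (Fin (N+2)) ℂ :=
    Matrix.of (Fin.cons b (Fin.cons c W) : Fin (N+2) → Fin (N+2) → ℂ) with hA
  let L : (Fin (N+2) → ℂ) →ₗ[ℂ] ℂ :=
    (Matrix.detRowAlternating (R := ℂ) (n := Fin (N+2))).toMultilinearMap.toLinearMap
      (Fin.cons a (Fin.cons d W)) 1
  have hL : ∀ y, L y = Matrix.det
      (Matrix.of (Fin.cons a (Fin.cons y W) : Fin (N+2) → Fin (N+2) → ℂ)) := by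
    intro y
    show Matrix.det (Function.update (Fin.cons a (Fin.cons d W) :
      Fin (N+2) → Fin (N+2) → ℂ) 1 y) = _
    congr 1
    ext i j
    refine Fin.cases ?_ (fun i => Fin.cases ?_ (fun i => ?_) i) i
    · simp [Function.update]
    · simp [Function.update]
    · simp [Function.update, Fin.ext_iff]
  have key : ∑ i, (A.updateRow i d).det • (A i) = A.det • d := by
    have h := Matrix.mulVec_cramer A.transpose d
    rw [Matrix.det_transpose] at h
    rw [← h]
    ext k
    simp [Matrix.mulVec, dotProduct, Matrix.cramer_transpose_apply, mul_comm]
  have h2 := congrArg L key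
  rw [map_sum, map_smul, Fin.sum_univ_succ, Fin.sum_univ_succ] at h2
  have hLs : ∀ (r : ℂ) y, L (r • y) = r * L y := fun r y => L.map_smul r y
  simp only [hLs, hL, smul_eq_mul] at h2
  rw [← h2, ← add_assoc]
  have e1 : A.updateRow 0 d =
      Matrix.of (Fin.cons d (Fin.cons c W) : Fin (N+2) → Fin (N+2) → ℂ) := by
    ext i j
    refine Fin.cases ?_ (fun i => ?_) i
    · simp
    · simp [hA, Matrix.updateRow_apply]
  have e2 : A.updateRow (Fin.succ 0) d =
      Matrix.of (Fin.cons b (Fin.cons d W) : Fin (N+2) → Fin (N+2) → ℂ) := by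
    ext i j
    refine Fin.cases ?_ (fun i => Fin.cases ?_ (fun i => ?_) i) i
    · simp [hA, Matrix.updateRow_apply]
    · simp [hA, Matrix.updateRow_apply]
    · simp [hA, Matrix.updateRow_apply, Fin.ext_iff]
  have e3 : ∀ i : Fin N, Matrix.det
      (Matrix.of (Fin.cons a (Fin.cons (A i.succ.succ) W) : Fin (N+2) → Fin (N+2) → ℂ)) = 0 := by
    intro i
    refine Matrix.det_zero_of_row_eq (i := Fin.succ 0) (j := i.succ.succ) ?_ ?_
    · simp [Fin.ext_iff]
    · ext k
      simp [hA]
  have e4 : ∑ i : Fin N, (A.updateRow i.succ.succ d).det * Matrix.det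
      (Matrix.of (Fin.cons a (Fin.cons (A i.succ.succ) W) : Fin (N+2) → Fin (N+2) → ℂ)) = 0 :=
    Finset.sum_eq_zero fun i _ => by rw [e3 i, mul_zero]
  have e5 : A 0 = b := rfl
  have e6 : A (Fin.succ 0) = c := rfl
  rw [e1, e2, e5, e6]
  exact (congrArg _ e4).trans (add_zero _)

theorem bl5_ones {n : ℕ} (V : Fin n → Fin (n+1) → ℂ) :
    Matrix.det (Matrix.of (Fin.cons (fun _ => 1) V : Fin (n+1) → Fin (n+1) → ℂ)) =
    Matrix.det (Matrix.of fun i j : Fin n => V i j.succ - V i j.castSucc) := by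
  rw [Matrix.det_eq_of_forall_col_eq_smul_add_pred
    (B := Matrix.of (fun i j => Fin.cases ((Fin.cons (fun _ => 1) V : Fin (n+1) → Fin (n+1) → ℂ) i 0)
      (fun k => (Fin.cons (fun _ => 1) V : Fin (n+1) → Fin (n+1) → ℂ) i k.succ
        - (Fin.cons (fun _ => 1) V : Fin (n+1) → Fin (n+1) → ℂ) i k.castSucc) j)) (fun _ => 1)]
  · rw [Matrix.det_succ_row_zero, Fin.sum_univ_succ]
    simp [Matrix.submatrix]
  · intro i; simp
  · intro i j; simp

theorem bl5_e0 {n : ℕ} (c : ℂ) (V : Fin n → Fin (n+1) → ℂ) (x : Fin (n+1) → ℂ)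
    (h0 : x 0 = c) (h1 : ∀ j : Fin n, x j.succ = 0) :
    Matrix.det (Matrix.of (Fin.cons x V : Fin (n+1) → Fin (n+1) → ℂ)) =
    c * Matrix.det (Matrix.of fun i j : Fin n => V i j.succ) := by
  rw [Matrix.det_succ_row_zero, Fin.sum_univ_succ]
  simp [Matrix.submatrix, h0, h1]

theorem bl5_el {n : ℕ} (V : Fin n → Fin (n+1) → ℂ) (x : Fin (n+1) → ℂ)
    (h0 : x (Fin.last n) = 1) (h1 : ∀ j : Fin n, x j.castSucc = 0) :
    Matrix.det (Matrix.of (Fin.cons x V : Fin (n+1) → Fin (n+1) → ℂ)) =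
    (-1)^n * Matrix.det (Matrix.of fun i j : Fin n => V i j.castSucc) := by
  rw [Matrix.det_succ_row_zero, Fin.sum_univ_castSucc]
  simp [Matrix.submatrix, h0, h1]

theorem bl5_scale {n : ℕ} (M : Fin n → Fin n → ℂ) (r s : Fin n → ℂ) :
    Matrix.det (Matrix.of fun i j : Fin n => r i * (s j * M j i)) =
    (∏ i, r i) * (∏ i, s i) * Matrix.det (Matrix.of M) := by
  have h := Matrix.det_mul_column r (Matrix.of fun i j : Fin n => s j * M j i)
  have h' := Matrix.det_mul_row s (Matrix.of fun i j : Fin n => M j i)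
  simp only [Matrix.of_apply] at h h'
  rw [h, h', ← Matrix.det_transpose (Matrix.of M), mul_assoc]
  rfl

theorem bl5_uni {n : ℕ} (C : Fin (n+1) → Fin (n+1) → ℂ) (g : Fin n → ℂ)
    (W : Fin n → Fin (n+1) → ℂ) (h : ∀ i j, C i.succ j = W i j + g i * C i.castSucc j) :
    Matrix.det (Matrix.of (Fin.cons (C 0) W : Fin (n+1) → Fin (n+1) → ℂ)) =
    Matrix.det (Matrix.of C) := by
  symm
  apply Matrix.det_eq_of_forall_row_eq_smul_add_pred g
  · intro j; simp
  · intro i j; simp [h]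

theorem bilinear_bl5 (q : ℂ) (hq : q ≠ 0) (ψ : ℂ → ℂ → ℂ → ℂ)
    (hre1 : ∀ t b1 b3 : ℂ, t ≠ 0 → b1 ≠ 0 → b3 ≠ 0 →
      ψ (q * t) b1 b3 = b1 * ψ t b1 b3 + (1 - b1) * ψ (q * t) (b1 / q) b3)
    (hre2 : ∀ t b1 b3 : ℂ, t ≠ 0 → b1 ≠ 0 → b3 ≠ 0 →
      b3 * ψ (q * t) b1 b3 = ψ t b1 b3 + (b3 - 1) * ψ t b1 (q * b3))
    (hre3 : ∀ t b1 b3 : ℂ, t ≠ 0 → b1 ≠ 0 → b3 ≠ 0 →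
      q * t * b1 * b3 * ψ (q * t) b1 b3 = (q * t * b1 - 1) * ψ t b1 b3 + ψ t (q * b1) b3)
    (hre4 : ∀ t b1 b3 : ℂ, t ≠ 0 → b1 ≠ 0 → b3 ≠ 0 →
      q * t * ψ (q * t) b1 b3 = (q * t * b1 - 1) * ψ t b1 b3 + ψ (q * t) b1 (b3 / q))
    (t b1 b3 : ℂ) (ht : t ≠ 0) (hb1 : b1 ≠ 0) (hb3 : b3 ≠ 0)
    (hgen1 : ∀ j : ℤ, q ^ j * b1 ≠ 1)
    (hgen2 : ∀ j : ℤ, q ^ j * t * b1 ≠ 1)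
    (hgen3 : ∀ j : ℤ, q ^ j * b3 ≠ 1) :
    ∀ N : ℕ,
      q ^ (-(N : ℤ)) * tauS q ψ N (-1) 1 t b1 b3 * tauS q ψ (N + 1) 0 1 t b1 b3
        - tauS q ψ N (-1) 2 t b1 b3 * tauS q ψ (N + 1) 0 0 t b1 b3
        + q ^ ((N : ℤ) + 1) * t * b3 * (1 - q ^ (-(N : ℤ)) * b1)
            * tauS q ψ N 0 1 (t / q) b1 b3 * tauS q ψ (N + 1) (-1) 1 (q * t) b1 b3 = 0 := by
  intro N
  -- three-term relation
  have three : ∀ T x y : ℂ, T ≠ 0 → x ≠ 0 → y ≠ 0 →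
      ψ T x (q * y) - ψ T x y = - (1 - x) * (q * T * y * ψ (q * T) (x / q) (q * y)) := by
    intro T x y hT hx hy
    have h1 := hre1 T x (q * y) hT hx (mul_ne_zero hq hy)
    have h2 := hre2 T x y hT hx hy
    have h4 := hre4 T x (q * y) hT hx (mul_ne_zero hq hy)
    rw [mul_div_cancel_left₀ _ hq] at h4
    linear_combination (-q * T * y) * h1 + y * h4 + h2
  have hqz : ∀ m : ℤ, q ^ m ≠ 0 := fun m => zpow_ne_zero m hq
  -- integer-indexed
  have three' : ∀ (T : ℂ) (m n : ℤ), T ≠ 0 →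
      ψ T (q ^ m * b1) (q ^ (n+1) * b3) - ψ T (q ^ m * b1) (q ^ n * b3) =
        - (1 - q ^ m * b1) * (q ^ (n+1) * T * b3 *
          ψ (q * T) (q ^ (m-1) * b1) (q ^ (n+1) * b3)) := by
    intro T m n hT
    have h := three T (q ^ m * b1) (q ^ n * b3) hT (mul_ne_zero (hqz m) hb1)
      (mul_ne_zero (hqz n) hb3)
    have e1 : q * (q ^ n * b3) = q ^ (n+1) * b3 := by rw [zpow_add_one₀ hq]; ring
    have e2 : q ^ m * b1 / q = q ^ (m-1) * b1 := by rw [zpow_sub_one₀ hq]; ring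
    rw [e1, e2] at h
    rw [h, zpow_add_one₀ hq]; ring
  let β : ℕ → ℂ := fun i => - (q ^ (-(i:ℤ)) * b1) / (1 - q ^ (-(i:ℤ)) * b1)
  have hx1 : ∀ m : ℤ, 1 - q ^ m * b1 ≠ 0 := fun m h => hgen1 m (sub_eq_zero.1 h).symm
  have hβ : ∀ i, β i ≠ 0 := fun i =>
    div_ne_zero (neg_ne_zero.2 (mul_ne_zero (hqz _) hb1)) (hx1 _)
  have htq : t / q ≠ 0 := div_ne_zero ht hq
  have hqt : q * (t / q) = t := mul_div_cancel₀ t hq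
  let C : ℕ → ℕ → ℂ := fun i n => ψ t (q ^ (-(i:ℤ)) * b1) (q ^ (n:ℤ) * b3)
  let W : ℕ → ℕ → ℂ := fun i n => β i * ψ (t/q) (q ^ (-(i:ℤ)) * b1) (q ^ (n:ℤ) * b3)
  have hCW : ∀ i n, C (i+1) n = W i n + (1 - q ^ (-(i:ℤ)) * b1)⁻¹ * C i n := by
    intro i n
    have h := hre1 (t/q) (q ^ (-(i:ℤ)) * b1) (q ^ (n:ℤ) * b3) htq (mul_ne_zero (hqz _) hb1)
      (mul_ne_zero (hqz _) hb3)
    have e2 : q ^ (-(i:ℤ)) * b1 / q = q ^ (-((i+1:ℕ):ℤ)) * b1 := by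
      rw [show -((i+1:ℕ):ℤ) = -(i:ℤ) - 1 by push_cast; ring, zpow_sub_one₀ hq]; ring
    rw [hqt, e2] at h
    have := hx1 (-(i:ℤ))
    simp only [C, W, β]
    rw [div_mul_eq_mul_div, inv_mul_eq_div, ← add_div, eq_div_iff this, h]
    ring
  have hCd : ∀ i n, C i (n+1) - C i n = - (1 - q ^ (-(i:ℤ)) * b1) * (q ^ ((n:ℤ)+1) * t * b3 *
      ψ (q * t) (q ^ (-(i:ℤ)) * (q ^ (-1:ℤ) * b1)) (q ^ (n:ℤ) * (q ^ (1:ℤ) * b3))) := by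
    intro i n
    have h := three' t (-(i:ℤ)) n ht
    simp only [C]
    push_cast
    rw [h, ← mul_assoc (q ^ (-(i:ℤ))), ← zpow_add₀ hq, ← mul_assoc (q ^ (n:ℤ)), ← zpow_add₀ hq]
    rfl
  have hWd : ∀ i n, W i (n+1) - W i n = (β i * -(1 - q ^ (-(i:ℤ)) * b1)) * (q ^ (n:ℤ) * t * b3 *
      ψ t (q ^ (-(i:ℤ)) * (q ^ (-1:ℤ) * b1)) (q ^ (n:ℤ) * (q ^ (1:ℤ) * b3))) := by
    intro i n
    have h := three' (t/q) (-(i:ℤ)) n htq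
    simp only [W]
    push_cast
    rw [← mul_sub, h, hqt, ← mul_assoc (q ^ (-(i:ℤ))), ← zpow_add₀ hq, ← mul_assoc (q ^ (n:ℤ)),
      ← zpow_add₀ hq, zpow_add_one₀ hq, ← sub_eq_add_neg]
    field_simp
  let g : Fin N → ℂ := fun i => (1 - q ^ (-((i:ℕ):ℤ)) * b1)⁻¹
  let Wv : Fin N → Fin (N+2) → ℂ := fun i n => W i n
  let a : Fin (N+2) → ℂ := fun n => C 0 n
  let u : Fin (N+2) → ℂ := fun _ => 1
  let e0 : Fin (N+2) → ℂ := fun j => if (j:ℕ) = 0 then 1 else 0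
  let el : Fin (N+2) → ℂ := fun j => if (j:ℕ) = N+1 then 1 else 0
  let f : (Fin (N+2) → ℂ) → (Fin (N+2) → ℂ) → ℂ := fun x y =>
    Matrix.det (Matrix.of (Fin.cons x (Fin.cons y Wv) : Fin (N+2) → Fin (N+2) → ℂ))
  have PB : f u e0 * f el a = f a e0 * f el u + f u a * f el e0 := bl5_plucker Wv el u e0 a
  have fswap : ∀ x y, f x y = - f y x := by
    intro x y
    have h := Matrix.det_permute (Equiv.swap (0 : Fin (N+2)) 1)
      (Matrix.of (Fin.cons y (Fin.cons x Wv) : Fin (N+2) → Fin (N+2) → ℂ))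
    have e : (Matrix.of (Fin.cons y (Fin.cons x Wv) : Fin (N+2) → Fin (N+2) → ℂ)).submatrix
        (Equiv.swap (0 : Fin (N+2)) 1) id =
        Matrix.of (Fin.cons x (Fin.cons y Wv) : Fin (N+2) → Fin (N+2) → ℂ) := by
      ext i j
      refine Fin.cases ?_ (fun i => Fin.cases ?_ (fun i => ?_) i) i
      · simp
      · simp
      · have : Equiv.swap (0 : Fin (N+2)) 1 i.succ.succ = i.succ.succ :=
          Equiv.swap_apply_of_ne_of_ne (by simp [Fin.ext_iff]) (by simp [Fin.ext_iff])
        simp [this]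
    rw [e, Equiv.Perm.sign_swap (by simp)] at h
    simpa [f] using h
  -- tails
  have tail : ∀ (κ : Fin (N+1) → Fin (N+2)), Matrix.det (Matrix.of fun i j : Fin (N+1) =>
      (Fin.cons a Wv : Fin (N+1) → Fin (N+2) → ℂ) i (κ j)) =
      Matrix.det (Matrix.of fun i j : Fin (N+1) => C i (κ j)) := by
    intro κ
    rw [← bl5_uni (fun i j : Fin (N+1) => C i (κ j)) g (fun i j => Wv i (κ j))]
    · congr 1
      ext i j
      refine Fin.cases ?_ (fun i => ?_) i
      · simp [a]
      · simp
    · intro i j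
      simp only [Fin.val_succ, Fin.val_castSucc, Wv, g]
      exact hCW _ _
  have tauT : ∀ (n : ℕ) (T x y : ℂ), tau q ψ n T x y = Matrix.det (Matrix.of
      fun i j : Fin n => ψ T (q ^ (-((i:ℕ):ℤ)) * x) (q ^ ((j:ℕ):ℤ) * y)) := by
    intro n T x y
    rw [tau, ← Matrix.det_transpose]
    rfl
  have F1 : f e0 a = tauS q ψ (N+1) 0 1 t b1 b3 := by
    simp only [f]
    rw [bl5_e0 1 _ _ (by simp [e0]) (by simp [e0]), one_mul, tail, tauS, tauT]
    congr 1
    ext i j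
    simp [C, pow_succ, mul_assoc]
  have F2 : f el a = (-1)^(N+1) * tauS q ψ (N+1) 0 0 t b1 b3 := by
    simp only [f]
    rw [bl5_el _ _ (by simp [el]) (by intro j; simp [el]; exact j.2.ne), tail, tauS, tauT]
    simp [C]
  have F3 : f u a = (∏ i : Fin (N+1), - (1 - q ^ (-((i:ℕ):ℤ)) * b1)) *
      (∏ n : Fin (N+1), q ^ (((n:ℕ):ℤ)+1) * t * b3) * tauS q ψ (N+1) (-1) 1 (q*t) b1 b3 := by
    simp only [f, u]
    rw [bl5_ones, tauS, tau, ← bl5_scale]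
    have h : (Matrix.of fun i j : Fin (N+1) => (Fin.cons a Wv : Fin (N+1) → Fin (N+2) → ℂ) i j.succ
        - (Fin.cons a Wv : Fin (N+1) → Fin (N+2) → ℂ) i j.castSucc).det =
        Matrix.det (Matrix.of fun i j : Fin (N+1) => C i (j+1) - C i j) := by
      rw [← bl5_uni (fun i j : Fin (N+1) => C i (j+1) - C i j) g
        (fun i j => Wv i j.succ - Wv i j.castSucc)]
      · congr 1
        ext i j
        refine Fin.cases ?_ (fun i => ?_) i
        · simp [a]
        · simp
      · intro i j
        simp only [Fin.val_succ, Fin.val_castSucc, Wv, g, hCW]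
        ring
    rw [h]
    simp only [hCd]
  have F4 : f e0 el = (-1)^N * ((∏ i : Fin N, β i) * tauS q ψ N 0 1 (t/q) b1 b3) := by
    simp only [f]
    rw [bl5_e0 1 _ _ (by simp [e0]) (by simp [e0]), one_mul]
    have h : (Matrix.of fun i j : Fin (N+1) =>
        (Fin.cons el Wv : Fin (N+1) → Fin (N+2) → ℂ) i j.succ) =
        Matrix.of (Fin.cons (fun j : Fin (N+1) => el j.succ) (fun i j => Wv i j.succ) :
          Fin (N+1) → Fin (N+1) → ℂ) := by
      ext i j
      refine Fin.cases ?_ (fun i => ?_) i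
      · simp
      · simp
    rw [h, bl5_el _ _ (by simp [el]) (by intro j; simp [el]; exact j.2.ne), tauS, tau]
    have := bl5_scale (fun i j : Fin N => ψ (t/q) (q ^ (-((j:ℕ):ℤ)) * (q ^ (0:ℤ) * b1))
      (q ^ ((i:ℕ):ℤ) * (q ^ (1:ℤ) * b3))) (fun i => β i) (fun _ => 1)
    simp only [Finset.prod_const_one, mul_one] at this
    rw [← this]
    congr 2
    ext i j
    simp [Wv, W, pow_succ, mul_assoc]
  have F5 : f u e0 = -((∏ i : Fin N, β i * -(1 - q ^ (-((i:ℕ):ℤ)) * b1)) *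
      (∏ n : Fin N, q ^ (((n:ℕ):ℤ)+1) * t * b3) * tauS q ψ N (-1) 2 t b1 b3) := by
    simp only [f, u]
    rw [bl5_ones, tauS, tau, ← bl5_scale]
    have h : (Matrix.of fun i j : Fin (N+1) => (Fin.cons e0 Wv : Fin (N+1) → Fin (N+2) → ℂ) i j.succ
        - (Fin.cons e0 Wv : Fin (N+1) → Fin (N+2) → ℂ) i j.castSucc) =
        Matrix.of (Fin.cons (fun j : Fin (N+1) => e0 j.succ - e0 j.castSucc)
          (fun i j => Wv i j.succ - Wv i j.castSucc) : Fin (N+1) → Fin (N+1) → ℂ) := by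
      ext i j
      refine Fin.cases ?_ (fun i => ?_) i
      · simp
      · simp
    rw [h, bl5_e0 (-1) _ _ (by simp [e0]) (by intro j; simp [e0]), neg_one_mul]
    congr 2
    ext i j
    have h := hWd i (j+1)
    have e : q ^ ((j:ℕ):ℤ) * (q ^ (2:ℤ) * b3) = q ^ (((j+1:ℕ)):ℤ) * (q ^ (1:ℤ) * b3) := by
      rw [← mul_assoc, ← mul_assoc, ← zpow_add₀ hq, ← zpow_add₀ hq]
      push_cast
      congr 2
    simp only [Matrix.of_apply, Wv, Fin.val_succ, Fin.val_castSucc, e]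
    rw [h]
    push_cast
    rfl
  have F6 : f u el = (-1)^N * ((∏ i : Fin N, β i * -(1 - q ^ (-((i:ℕ):ℤ)) * b1)) *
      (∏ n : Fin N, q ^ ((n:ℕ):ℤ) * t * b3) * tauS q ψ N (-1) 1 t b1 b3) := by
    simp only [f, u]
    rw [bl5_ones, tauS, tau, ← bl5_scale]
    have h : (Matrix.of fun i j : Fin (N+1) => (Fin.cons el Wv : Fin (N+1) → Fin (N+2) → ℂ) i j.succ
        - (Fin.cons el Wv : Fin (N+1) → Fin (N+2) → ℂ) i j.castSucc) =
        Matrix.of (Fin.cons (fun j : Fin (N+1) => el j.succ - el j.castSucc)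
          (fun i j => Wv i j.succ - Wv i j.castSucc) : Fin (N+1) → Fin (N+1) → ℂ) := by
      ext i j
      refine Fin.cases ?_ (fun i => ?_) i
      · simp
      · simp
    rw [h, bl5_el _ _ (by simp [el]) (by
      intro j
      have h1 := j.2
      have h2 : (j:ℕ) ≠ N := by omega
      have h3 : (j:ℕ) ≠ N + 1 := by omega
      simp [el, h2, h3])]
    congr 2
    ext i j
    simp only [Matrix.of_apply, Wv, Fin.val_succ, Fin.val_castSucc]
    rw [hWd]
  rw [fswap a e0, fswap el u, fswap el e0, F1, F2, F3, F4, F5, F6] at PB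
  rw [Fin.prod_univ_castSucc, Fin.prod_univ_castSucc, Finset.prod_mul_distrib] at PB
  have hP : (∏ n : Fin N, q ^ ((n:ℕ):ℤ) * t * b3) =
      q ^ (-(N:ℤ)) * ∏ n : Fin N, q ^ (((n:ℕ):ℤ)+1) * t * b3 := by
    have : (∏ n : Fin N, q ^ (((n:ℕ):ℤ)+1) * t * b3) =
        q ^ (N:ℤ) * ∏ n : Fin N, q ^ ((n:ℕ):ℤ) * t * b3 := by
      rw [zpow_natCast]
      conv_rhs => rw [← Fin.prod_const N q, ← Finset.prod_mul_distrib]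
      refine Finset.prod_congr rfl fun n _ => ?_
      rw [zpow_add_one₀ hq]; ring
    rw [this, ← mul_assoc, ← zpow_add₀ hq]
    simp
  rw [hP] at PB
  simp only [Fin.val_castSucc, Fin.val_last] at PB
  set X := ∏ i : Fin N, β i
  set Y := ∏ i : Fin N, -(1 - q ^ (-((i:ℕ):ℤ)) * b1)
  set Z := ∏ n : Fin N, q ^ (((n:ℕ):ℤ)+1) * t * b3
  have hX : X ≠ 0 := Finset.prod_ne_zero_iff.2 fun i _ => hβ i
  have hY : Y ≠ 0 := Finset.prod_ne_zero_iff.2 fun i _ => neg_ne_zero.2 (hx1 _)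
  have hZ : Z ≠ 0 := Finset.prod_ne_zero_iff.2 fun i _ =>
    mul_ne_zero (mul_ne_zero (hqz _) ht) hb3
  have hs : ((-1:ℂ))^N ≠ 0 := pow_ne_zero _ (by norm_num)
  refine (mul_eq_zero.1 (?_ : ((-1)^N * X * Y * Z) * _ = 0)).resolve_left
    (mul_ne_zero (mul_ne_zero (mul_ne_zero hs hX) hY) hZ)
  linear_combination -PB
end

section
/- (Bilinear equation bl6.) Suppose ψ satisfies the contiguous relations (re1)–(re4), and fix nonzero t, b₁, b₃ ∈ ℂ such that qʲ·b₁ ≠ 1, qʲ·t·b₁ ≠ 1 and qʲ·b₃ ≠ 1 for every integer j. Then for every integer N ≥ 0: q^{−N}·t·τ_N^{−1,1}(t)·τ_{N+1}^{0,1}(t) − τ_N^{−1,2}(t)·τ_{N+1}^{0,0}(t) + (1 − q^{−N}·t·b₁)·τ_N^{−1,1}(qt)·τ_{N+1}^{0,1}(t/q) = 0. -/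
/-- Two-variable kernel used in the symmetry argument. -/
noncomputable def kap (x β : ℕ → ℂ) (s : ℕ → ℕ → ℂ) : ℕ → ℕ → ℕ → ℂ
  | 0, l, i => s i l
  | m + 1, l, i => kap x β s m l i + x m * (β i - 1) * kap x β s m l (i + 1)

lemma kap_succ_right (x β : ℕ → ℂ) (s : ℕ → ℕ → ℂ)
    (hL : ∀ i m, s i (m + 1) - s i m = x m * (β i - 1) * s (i + 1) m) (m : ℕ) :
    ∀ l i, kap x β s m (l + 1) i
      = kap x β s m l i + x l * (β i - 1) * kap x β s m l (i + 1) := by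
  induction m with
  | zero => intro l i; simp only [kap]; linear_combination hL i l
  | succ m ih =>
    intro l i
    simp only [kap]
    rw [ih l i, ih l (i + 1)]
    ring

lemma kap_symm (x β : ℕ → ℂ) (s : ℕ → ℕ → ℂ)
    (hL : ∀ i m, s i (m + 1) - s i m = x m * (β i - 1) * s (i + 1) m) (m : ℕ) :
    ∀ l i, kap x β s m l i = kap x β s l m i := by
  induction m with
  | zero =>
    intro l
    induction l with
    | zero => intro i; rfl
    | succ l ih =>
      intro i
      rw [kap_succ_right x β s hL]
      simp only [kap]
      rw [← ih, ← ih]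
      simp only [kap]
  | succ m ih =>
    intro l i
    rw [kap_succ_right x β s hL]
    simp only [kap]
    rw [ih, ih]

lemma core (N : ℕ) (t : ℂ) (x β : ℕ → ℂ) (r s : ℕ → ℕ → ℂ) (n : ℕ → ℂ)
    (hL : ∀ i m, s i (m + 1) - s i m = x m * (β i - 1) * s (i + 1) m)
    (hD : ∀ i m, (1 - x m) * s (i + 1) m = r i m - t * r (i + 1) m)
    (hB : ∀ i m, β i * r i m = s i m + (β i - 1) * s (i + 1) m)
    (hn : ∀ i, i < N → ∑ l ∈ Finset.range (N + 1), n l * r (i + 1) l = 0) :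
    (∑ m ∈ Finset.range (N + 1), n m) * (∑ l ∈ Finset.range (N + 1), n l * r 0 l)
      - t * n N * ((∏ k ∈ Finset.range N, x k) * ∏ k ∈ Finset.range N, (β (k + 1) - 1))
          * (∑ l ∈ Finset.range (N + 1), n l * r (N + 1) l)
      - (∑ m ∈ Finset.range (N + 1), n m * ∏ k ∈ Finset.range (m + 1), (1 - x k))
          * (∑ l ∈ Finset.range (N + 1), n l * s 1 l) = 0 := by
  set F : ℕ → ℂ := fun i => ∑ l ∈ Finset.range (N + 1), n l * r i l with hF
  set G : ℕ → ℂ := fun i => ∑ l ∈ Finset.range (N + 1), n l * s i l with hG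
  have hF0 : ∀ i, i < N → F (i + 1) = 0 := hn
  have hGrec : ∀ i, i < N → (β (i + 1) - 1) * G (i + 2) = - G (i + 1) := by
    intro i hi
    have h1 : β (i + 1) * F (i + 1) = G (i + 1) + (β (i + 1) - 1) * G (i + 2) := by
      simp only [hF, hG, Finset.mul_sum, ← Finset.sum_add_distrib]
      refine Finset.sum_congr rfl fun l _ => ?_
      linear_combination n l * hB (i + 1) l
    rw [hF0 i hi] at h1
    linear_combination -h1
  have hg : ∀ m i, i + m ≤ N → ∑ l ∈ Finset.range (N + 1), n l * kap x β s m l (i + 1)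
      = (∏ k ∈ Finset.range m, (1 - x k)) * G (i + 1) := by
    intro m
    induction m with
    | zero => intro i _; simp [kap, hG]
    | succ m ih =>
      intro i hi
      have e : ∑ l ∈ Finset.range (N + 1), n l * kap x β s (m + 1) l (i + 1)
          = ∑ l ∈ Finset.range (N + 1), n l * kap x β s m l (i + 1)
            + x m * (β (i + 1) - 1) *
              ∑ l ∈ Finset.range (N + 1), n l * kap x β s m l (i + 1 + 1) := by
        rw [Finset.mul_sum, ← Finset.sum_add_distrib]
        refine Finset.sum_congr rfl fun l _ => ?_
        simp only [kap]; ring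
      rw [e, ih i (by omega), ih (i + 1) (by omega), Finset.prod_range_succ]
      linear_combination (x m * ∏ k ∈ Finset.range m, (1 - x k)) * hGrec i (by omega)
  have hh : ∀ m i, i + m ≤ N →
      ∑ l ∈ Finset.range (N + 1), n l * (1 - x l) * kap x β s m l (i + 1)
      = (if i = 0 then F 0 else 0) - (if i + m = N then
          (∏ k ∈ Finset.range m, x k) * (∏ k ∈ Finset.range m, (β (i + 1 + k) - 1))
            * (t * F (N + 1)) else 0) := by
    intro m
    induction m with
    | zero =>
      intro i hi
      have e : ∑ l ∈ Finset.range (N + 1), n l * (1 - x l) * kap x β s 0 l (i + 1)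
          = F i - t * F (i + 1) := by
        simp only [hF, Finset.mul_sum, ← Finset.sum_sub_distrib]
        refine Finset.sum_congr rfl fun l _ => ?_
        simp only [kap]
        linear_combination n l * hD i l
      rw [e]
      have e1 : F i = if i = 0 then F 0 else 0 := by
        split_ifs with h
        · rw [h]
        · obtain ⟨k, rfl⟩ := Nat.exists_eq_succ_of_ne_zero h
          exact hF0 k (by omega)
      rw [e1]
      congr 1
      split_ifs with h
      · have : i = N := by omega
        subst this; simp
      · rw [hF0 i (by omega)]; simp
    | succ m ih =>
      intro i hi
      have e : ∑ l ∈ Finset.range (N + 1), n l * (1 - x l) * kap x β s (m + 1) l (i + 1)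
          = ∑ l ∈ Finset.range (N + 1), n l * (1 - x l) * kap x β s m l (i + 1)
            + x m * (β (i + 1) - 1) *
              ∑ l ∈ Finset.range (N + 1), n l * (1 - x l) * kap x β s m l (i + 1 + 1) := by
        rw [Finset.mul_sum, ← Finset.sum_add_distrib]
        refine Finset.sum_congr rfl fun l _ => ?_
        simp only [kap]; ring
      rw [e, ih i (by omega), ih (i + 1) (by omega)]
      rw [if_neg (show ¬ (i + m = N) by omega), if_neg (show ¬ (i + 1 = 0) by omega)]
      by_cases h : i + (m + 1) = N
      · rw [if_pos h, if_pos (show i + 1 + m = N by omega), Finset.prod_range_succ,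
          Finset.prod_range_succ' (fun k => β (i + 1 + k) - 1)]
        have : ∏ k ∈ Finset.range m, (β (i + 1 + (k + 1)) - 1)
            = ∏ k ∈ Finset.range m, (β (i + 1 + 1 + k) - 1) :=
          Finset.prod_congr rfl fun k _ => by
            rw [show i + 1 + (k + 1) = i + 1 + 1 + k by omega]
        rw [this, add_zero]
        ring
      · rw [if_neg h, if_neg (show ¬ (i + 1 + m = N) by omega)]
        ring
  -- the antisymmetric double sum vanishes
  have hz : ∑ m ∈ Finset.range (N + 1), ∑ l ∈ Finset.range (N + 1),
      n m * (n l * (1 - x l) * kap x β s m l (0 + 1))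
      = ∑ m ∈ Finset.range (N + 1), ∑ l ∈ Finset.range (N + 1),
      n m * (1 - x m) * (n l * kap x β s m l (0 + 1)) := by
    rw [Finset.sum_comm]
    refine Finset.sum_congr rfl fun m _ => Finset.sum_congr rfl fun l _ => ?_
    rw [kap_symm x β s hL l m]
    ring
  simp only [← Finset.mul_sum] at hz
  have hz1 : ∑ m ∈ Finset.range (N + 1), n m * (F 0 - (if m = N then
          (∏ k ∈ Finset.range m, x k) * (∏ k ∈ Finset.range m, (β (k + 1) - 1))
            * (t * F (N + 1)) else 0))
      = ∑ m ∈ Finset.range (N + 1), n m * (∏ k ∈ Finset.range (m + 1), (1 - x k)) * G 1 := by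
    refine Eq.trans (Finset.sum_congr rfl fun m hm => ?_)
      (hz.trans (Finset.sum_congr rfl fun m hm => ?_))
    · rw [hh m 0 (by have := Finset.mem_range.1 hm; omega)]
      simp only [if_true, zero_add, add_comm 1]
    · rw [hg m 0 (by have := Finset.mem_range.1 hm; omega), Finset.prod_range_succ]
      ring
  simp only [mul_sub, Finset.sum_sub_distrib, ← Finset.sum_mul, mul_ite, mul_zero,
    Finset.sum_ite_eq', Finset.mem_range, Nat.lt_succ_self, if_true] at hz1
  change _ * F 0 - t * n N * _ * F (N + 1) - _ * G 1 = 0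
  linear_combination hz1

/-- bordered determinant -/
noncomputable def bd (N : ℕ) (r : ℕ → ℕ → ℂ) (v : ℕ → ℂ) : ℂ :=
  Matrix.det (Matrix.of fun i m : Fin (N + 1) =>
    (Fin.cons (v m) (fun k : Fin N => r ((k : ℕ) + 1) m) : Fin (N + 1) → ℂ) i)

/-- plain determinant -/
noncomputable def TT (N : ℕ) (r : ℕ → ℕ → ℂ) : ℂ :=
  Matrix.det (Matrix.of fun i m : Fin N => r i m)

lemma bd_lin (N : ℕ) (r : ℕ → ℕ → ℂ) : ∃ n : ℕ → ℂ,
    (∀ v, bd N r v = ∑ l ∈ Finset.range (N + 1), n l * v l) ∧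
    n N = (-1) ^ N * TT N (fun i m => r (i + 1) m) := by
  refine ⟨fun l => if h : l < N + 1 then (-1) ^ l * Matrix.det (Matrix.of fun i m : Fin N =>
    r ((i : ℕ) + 1) ((⟨l, h⟩ : Fin (N + 1)).succAbove m)) else 0, ?_, ?_⟩
  · intro v
    rw [bd, Matrix.det_succ_row_zero, Finset.sum_range]
    refine Finset.sum_congr rfl fun l _ => ?_
    simp only [Fin.is_lt, dif_pos, Matrix.of_apply, Fin.cons_zero, Fin.eta]
    have : (Matrix.of fun i m : Fin (N + 1) =>
        (Fin.cons (v m) (fun k : Fin N => r ((k : ℕ) + 1) m) : Fin (N + 1) → ℂ) i).submatrix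
          Fin.succ l.succAbove = Matrix.of fun i m : Fin N => r ((i : ℕ) + 1) (l.succAbove m) := by
      ext i m; simp
    rw [this]; ring
  · simp only [Nat.lt_succ_self, dif_pos, TT]
    congr 3
    ext i m
    have : (⟨N, Nat.lt_succ_self N⟩ : Fin (N + 1)) = Fin.last N := rfl
    rw [this]
    simp

lemma bd_zero (N : ℕ) (r : ℕ → ℕ → ℂ) (i : ℕ) (hi : i < N) : bd N r (r (i + 1)) = 0 := by
  refine Matrix.det_zero_of_row_eq (i := 0) (j := (⟨i, hi⟩ : Fin N).succ)
    (Fin.succ_ne_zero _).symm ?_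
  ext m
  simp only [Matrix.of_apply, Fin.cons_zero, Fin.cons_succ]

lemma bd_first (N : ℕ) (r : ℕ → ℕ → ℂ) : bd N r (r 0) = TT (N + 1) r := by
  unfold bd TT
  congr 1
  ext i m
  refine Fin.cases ?_ (fun k => ?_) i <;> simp

lemma bd_last (N : ℕ) (r : ℕ → ℕ → ℂ) :
    bd N r (r (N + 1)) = (-1) ^ N * TT (N + 1) (fun i m => r (i + 1) m) := by
  unfold bd TT
  have h := Matrix.det_permute (finRotate (N + 1)).symm
    (Matrix.of fun i m : Fin (N + 1) => r ((i : ℕ) + 1) m)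
  rw [Equiv.Perm.sign_symm, sign_finRotate, Nat.add_sub_cancel] at h
  have e : ((((-1) ^ N : ℤˣ) : ℤ) : ℂ) = (-1) ^ N := by simp
  rw [e] at h
  rw [← h]
  congr 1
  ext i m
  refine Fin.cases ?_ (fun k => ?_) i
  · have : (finRotate (N + 1)).symm 0 = Fin.last N := by
      rw [Equiv.symm_apply_eq]; simp
    simp [this]
  · have : (finRotate (N + 1)).symm k.succ = k.castSucc := by
      rw [Equiv.symm_apply_eq]; simp
    simp [this]

lemma bd_col (N : ℕ) (r : ℕ → ℕ → ℂ) (d w : ℕ → ℂ) (hw0 : w 0 = 1)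
    (hw : ∀ m, w (m + 1) = d m * w m) :
    bd N r w = TT N (fun i m => r (i + 1) (m + 1) - d m * r (i + 1) m) := by
  set B : Matrix (Fin (N + 1)) (Fin (N + 1)) ℂ := Matrix.of fun i m : Fin (N + 1) =>
    (Fin.cons ((Fin.cons 1 (fun _ : Fin N => 0) : Fin (N + 1) → ℂ) m)
      (fun k : Fin N => (Fin.cons (r ((k : ℕ) + 1) 0) (fun m : Fin N =>
        r ((k : ℕ) + 1) ((m : ℕ) + 1) - d m * r ((k : ℕ) + 1) m) : Fin (N + 1) → ℂ) m) :
      Fin (N + 1) → ℂ) i with hB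
  have h1 : bd N r w = B.det := by
    refine Matrix.det_eq_of_forall_col_eq_smul_add_pred (fun m => d m) ?_ ?_
    · intro i
      refine Fin.cases ?_ (fun k => ?_) i <;> simp [hB, hw0]
    · intro i j
      refine Fin.cases ?_ (fun k => ?_) i <;> simp [hB, hw]
  rw [h1, Matrix.det_succ_row_zero, Fin.sum_univ_succ]
  simp only [hB, Matrix.of_apply, Fin.cons_zero, Fin.cons_succ, mul_zero, zero_mul,
    Finset.sum_const_zero, add_zero, Fin.val_zero, pow_zero, one_mul, mul_one, TT]
  congr 1

lemma TT_scale (N : ℕ) (f g : ℕ → ℕ → ℂ) (a b : ℕ → ℂ)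
    (h : ∀ i m, f i m = a i * b m * g i m) :
    TT N f = (∏ i ∈ Finset.range N, a i) * (∏ i ∈ Finset.range N, b i) * TT N g := by
  unfold TT
  have h1 := Matrix.det_mul_column (fun i : Fin N => a i)
    (Matrix.of fun i j : Fin N => b j * g i j)
  have h2 := Matrix.det_mul_row (fun i : Fin N => b i) (Matrix.of fun i j : Fin N => g i j)
  simp only [Matrix.of_apply] at h1 h2
  rw [Finset.prod_range, Finset.prod_range, mul_assoc, ← h2, ← h1]
  congr 1
  ext i j
  simp [h, mul_assoc]

lemma bd_s (N : ℕ) (β : ℕ → ℂ) (r s : ℕ → ℕ → ℂ) (hβ : ∀ i, β i ≠ 1)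
    (hB : ∀ i m, β i * r i m = s i m + (β i - 1) * s (i + 1) m) :
    (∏ i ∈ Finset.range N, (β (i + 1) - 1)) * TT (N + 1) (fun i m => s (i + 1) m)
      = (∏ i ∈ Finset.range N, β (i + 1)) * bd N r (s 1) := by
  have hne : ∀ i, β i - 1 ≠ 0 := fun i => sub_ne_zero.2 (hβ i)
  set g : ℕ → ℂ := fun i => Nat.casesOn i 1 (fun k => β (k + 1) / (β (k + 1) - 1)) with hg
  have h1 : TT (N + 1) (fun i m => s (i + 1) m) = Matrix.det (Matrix.of fun i m : Fin (N + 1) =>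
      g i * (Matrix.of fun i m : Fin (N + 1) =>
    (Fin.cons (s 1 m) (fun k : Fin N => r ((k : ℕ) + 1) m) : Fin (N + 1) → ℂ) i) i m) := by
    refine Matrix.det_eq_of_forall_row_eq_smul_add_pred
      (fun k => -1 / (β ((k : ℕ) + 1) - 1)) ?_ ?_
    · intro j; simp [hg]
    · intro i j
      simp only [hg, Matrix.of_apply, Fin.val_succ, Fin.cons_succ, Fin.val_castSucc]
      have := hB (i + 1) j
      field_simp [hne (i + 1)]
      linear_combination -this
  rw [h1, Matrix.det_mul_column, Fin.prod_univ_succ]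
  have h2 : (∏ i ∈ Finset.range N, (β (i + 1) - 1)) * (g ((0 : Fin (N + 1)) : ℕ) *
      ∏ i : Fin N, g (i.succ : Fin (N + 1))) = ∏ i ∈ Finset.range N, β (i + 1) := by
    simp only [Fin.val_succ]
    rw [← Finset.prod_range (fun i => g (i + 1))]
    have hg0 : g ((0 : Fin (N + 1)) : ℕ) = 1 := rfl
    rw [hg0, one_mul]
    simp only [hg]
    rw [← Finset.prod_mul_distrib]
    refine Finset.prod_congr rfl fun i _ => ?_
    field_simp [hne (i + 1)]
  rw [← mul_assoc, h2, bd]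

lemma abstract_bl_s11 (N : ℕ) (q t : ℂ) (hq : q ≠ 0) (x β : ℕ → ℂ) (r s u : ℕ → ℕ → ℂ)
    (hx : ∀ m, x (m + 1) = q * x m) (hx0 : ∀ m, x m ≠ 0) (hβ : ∀ i, β i ≠ 1)
    (hL : ∀ i m, s i (m + 1) - s i m = x m * (β i - 1) * s (i + 1) m)
    (hD : ∀ i m, (1 - x m) * s (i + 1) m = r i m - t * r (i + 1) m)
    (hB : ∀ i m, β i * r i m = s i m + (β i - 1) * s (i + 1) m)
    (hL' : ∀ i m, r i (m + 1) - r i m = x (m + 1) * (β i - 1) * r (i + 1) m)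
    (hU : ∀ i m, r i (m + 1) - (1 - x (m + 1)) * r i m = x (m + 1) * β i * u i m) :
    q ^ (-(N : ℤ)) * t * TT N (fun i m => r (i + 1) m) * TT (N + 1) (fun i m => r (i + 1) m)
      - TT N (fun i m => r (i + 2) m) * TT (N + 1) r
      + (1 - x 0) * TT N (fun i m => u (i + 1) m) * TT (N + 1) (fun i m => s (i + 1) m) = 0 := by
  obtain ⟨n, hn, hnN⟩ := bd_lin N r
  have hc := core N t x β r s n hL hD hB (fun i hi => by rw [← hn, bd_zero N r i hi])
  rw [← hn (r 0), ← hn (r (N + 1)), ← hn (s 1), bd_first, bd_last, hnN] at hc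
  have h1 : ∑ m ∈ Finset.range (N + 1), n m = bd N r (fun _ => 1) := by rw [hn]; simp
  have h2 : ∑ m ∈ Finset.range (N + 1), n m * ∏ k ∈ Finset.range (m + 1), (1 - x k)
      = (1 - x 0) * bd N r (fun m => ∏ k ∈ Finset.range m, (1 - x (k + 1))) := by
    rw [hn, Finset.mul_sum]
    refine Finset.sum_congr rfl fun m _ => ?_
    rw [Finset.prod_range_succ']
    ring
  have k1 : bd N r (fun _ => 1) = (∏ i ∈ Finset.range N, (β (i + 1) - 1))
      * (∏ i ∈ Finset.range N, x (i + 1)) * TT N (fun i m => r (i + 2) m) := by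
    rw [bd_col N r (fun _ => 1) _ rfl (by simp)]
    exact TT_scale N _ (fun i m => r (i + 2) m) (fun i => β (i + 1) - 1) (fun m => x (m + 1))
      (fun i m => by linear_combination hL' (i + 1) m)
  have k2 : bd N r (fun m => ∏ k ∈ Finset.range m, (1 - x (k + 1)))
      = (∏ i ∈ Finset.range N, β (i + 1))
      * (∏ i ∈ Finset.range N, x (i + 1)) * TT N (fun i m => u (i + 1) m) := by
    rw [bd_col N r (fun m => 1 - x (m + 1)) _ (by simp)
      (fun m => by rw [Finset.prod_range_succ, mul_comm])]
    exact TT_scale N _ (fun i m => u (i + 1) m) (fun i => β (i + 1)) (fun m => x (m + 1))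
      (fun i m => by linear_combination hU (i + 1) m)
  rw [h1, h2, k1, k2] at hc
  have h3 := bd_s N β r s hβ hB
  have h4 : ∏ k ∈ Finset.range N, x (k + 1) = q ^ N * ∏ k ∈ Finset.range N, x k := by
    simp only [hx, Finset.prod_mul_distrib, Finset.prod_const, Finset.card_range]
  have h5 : (∏ k ∈ Finset.range N, x k) ≠ 0 := Finset.prod_ne_zero_iff.2 fun i _ => hx0 i
  have h6 : (∏ k ∈ Finset.range N, (β (k + 1) - 1)) ≠ 0 :=
    Finset.prod_ne_zero_iff.2 fun i _ => sub_ne_zero.2 (hβ _)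
  have h7 : q ^ N ≠ 0 := pow_ne_zero _ hq
  rw [h4] at hc
  have h8 : ((-1 : ℂ) ^ N) * (-1) ^ N = 1 := by rw [← mul_pow]; simp
  rw [zpow_neg, zpow_natCast]
  have h9 : (q ^ N)⁻¹ * q ^ N = 1 := inv_mul_cancel₀ h7
  refine (mul_eq_zero.1 (?_ : (q ^ N * (∏ k ∈ Finset.range N, x k) *
    ∏ k ∈ Finset.range N, (β (k + 1) - 1)) * _ = 0)).resolve_left
    (mul_ne_zero (mul_ne_zero h7 h5) h6)
  generalize (∏ k ∈ Finset.range N, x k) = X at *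
  generalize (∏ k ∈ Finset.range N, (β (k + 1) - 1)) = Pb at *
  generalize (∏ k ∈ Finset.range N, β (k + 1)) = Qb at *
  generalize ((-1 : ℂ) ^ N) = e at *
  generalize (q ^ N)⁻¹ = Qi at *
  generalize q ^ N = Q at *
  generalize TT N (fun i m => r (i + 1) m) = A1 at *
  generalize TT (N + 1) (fun i m => r (i + 1) m) = A2 at *
  generalize TT N (fun i m => u (i + 1) m) = A3 at *
  generalize TT (N + 1) (fun i m => s (i + 1) m) = A4 at *
  linear_combination -hc + (X * Pb * t * A1 * A2) * h9 - X * Pb * t * A1 * A2 * h8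
    + Q * X * (1 - x 0) * A3 * h3

lemma tau_rev (q : ℂ) (ψ : ℂ → ℂ → ℂ → ℂ) (N : ℕ) : ∃ e : ℂ, ∀ t b1 b3 : ℂ,
    tau q ψ N t b1 b3 = e * TT N (fun i m =>
      ψ t (q ^ ((m : ℤ) + 1 - (N : ℤ)) * b1) (q ^ (i : ℤ) * b3)) := by
  refine ⟨((Equiv.Perm.sign (Fin.revPerm (n := N)) : ℤ) : ℂ), fun t b1 b3 => ?_⟩
  rw [TT, ← Matrix.det_permute', tau]
  congr 1
  ext i m
  simp only [Matrix.of_apply, Matrix.submatrix_apply, id, Fin.revPerm_apply, Fin.val_rev]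
  congr 3
  have := m.2
  omega

theorem bilinear_bl6 (q : ℂ) (hq : q ≠ 0) (ψ : ℂ → ℂ → ℂ → ℂ)
    (hre1 : ∀ t b1 b3 : ℂ, t ≠ 0 → b1 ≠ 0 → b3 ≠ 0 →
      ψ (q * t) b1 b3 = b1 * ψ t b1 b3 + (1 - b1) * ψ (q * t) (b1 / q) b3)
    (hre2 : ∀ t b1 b3 : ℂ, t ≠ 0 → b1 ≠ 0 → b3 ≠ 0 →
      b3 * ψ (q * t) b1 b3 = ψ t b1 b3 + (b3 - 1) * ψ t b1 (q * b3))
    (hre3 : ∀ t b1 b3 : ℂ, t ≠ 0 → b1 ≠ 0 → b3 ≠ 0 →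
      q * t * b1 * b3 * ψ (q * t) b1 b3 = (q * t * b1 - 1) * ψ t b1 b3 + ψ t (q * b1) b3)
    (hre4 : ∀ t b1 b3 : ℂ, t ≠ 0 → b1 ≠ 0 → b3 ≠ 0 →
      q * t * ψ (q * t) b1 b3 = (q * t * b1 - 1) * ψ t b1 b3 + ψ (q * t) b1 (b3 / q))
    (t b1 b3 : ℂ) (ht : t ≠ 0) (hb1 : b1 ≠ 0) (hb3 : b3 ≠ 0)
    (hgen1 : ∀ j : ℤ, q ^ j * b1 ≠ 1)
    (hgen2 : ∀ j : ℤ, q ^ j * t * b1 ≠ 1)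
    (hgen3 : ∀ j : ℤ, q ^ j * b3 ≠ 1) :
    ∀ N : ℕ,
      q ^ (-(N : ℤ)) * t * tauS q ψ N (-1) 1 t b1 b3 * tauS q ψ (N + 1) 0 1 t b1 b3
        - tauS q ψ N (-1) 2 t b1 b3 * tauS q ψ (N + 1) 0 0 t b1 b3
        + (1 - q ^ (-(N : ℤ)) * t * b1)
            * tauS q ψ N (-1) 1 (q * t) b1 b3 * tauS q ψ (N + 1) 0 1 (t / q) b1 b3 = 0 := by

  intro N
  obtain ⟨e, he⟩ := tau_rev q ψ N
  obtain ⟨e', he'⟩ := tau_rev q ψ (N + 1)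
  set c : ℕ → ℂ := fun m => q ^ ((m : ℤ) - N) * b1 with hc
  set β : ℕ → ℂ := fun i => q ^ (i : ℤ) * b3 with hβ
  have hc0 : ∀ m, c m ≠ 0 := fun m => mul_ne_zero (zpow_ne_zero _ hq) hb1
  have hβ0 : ∀ m, β m ≠ 0 := fun m => mul_ne_zero (zpow_ne_zero _ hq) hb3
  have hcs : ∀ m, c (m + 1) = q * c m := by
    intro m
    simp only [hc]
    rw [← mul_assoc, ← zpow_one_add₀ hq]
    congr 2; push_cast; ring
  have hβs : ∀ m, β (m + 1) = q * β m := by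
    intro m
    simp only [hβ]
    rw [← mul_assoc, ← zpow_one_add₀ hq]
    congr 2; push_cast; ring
  have htq : t / q ≠ 0 := div_ne_zero ht hq
  have hqt : q * (t / q) = t := by field_simp
  have R2 : ∀ i m, β i * ψ t (c m) (β i)
      = ψ (t / q) (c m) (β i) + (β i - 1) * ψ (t / q) (c m) (β (i + 1)) := by
    intro i m
    have := hre2 (t / q) (c m) (β i) htq (hc0 m) (hβ0 i)
    rwa [hqt, ← hβs] at this
  have R2' : ∀ i m, β i * ψ (q * t) (c m) (β i)
      = ψ t (c m) (β i) + (β i - 1) * ψ t (c m) (β (i + 1)) := by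
    intro i m
    have := hre2 t (c m) (β i) ht (hc0 m) (hβ0 i)
    rwa [← hβs] at this
  have R3 : ∀ i m, t * c m * β i * ψ t (c m) (β i)
      = (t * c m - 1) * ψ (t / q) (c m) (β i) + ψ (t / q) (c (m + 1)) (β i) := by
    intro i m
    have := hre3 (t / q) (c m) (β i) htq (hc0 m) (hβ0 i)
    rwa [hqt, ← hcs] at this
  have R3' : ∀ i m, q * t * c m * β i * ψ (q * t) (c m) (β i)
      = (q * t * c m - 1) * ψ t (c m) (β i) + ψ t (c (m + 1)) (β i) := by
    intro i m
    have := hre3 t (c m) (β i) ht (hc0 m) (hβ0 i)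
    rwa [← hcs] at this
  have R4 : ∀ i m, t * ψ t (c m) (β (i + 1))
      = (t * c m - 1) * ψ (t / q) (c m) (β (i + 1)) + ψ t (c m) (β i) := by
    intro i m
    have := hre4 (t / q) (c m) (β (i + 1)) htq (hc0 m) (hβ0 _)
    rwa [hqt, show β (i + 1) / q = β i by rw [hβs]; field_simp] at this
  have key := abstract_bl_s11 N q t hq (fun m => t * c m) β
    (fun i m => ψ t (c m) (β i)) (fun i m => ψ (t / q) (c m) (β i))
    (fun i m => ψ (q * t) (c m) (β i))
    (fun m => by rw [hcs]; ring) (fun m => mul_ne_zero ht (hc0 m)) (fun i => hgen3 i)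
    (fun i m => by linear_combination (t * c m) * R2 i m - R3 i m)
    (fun i m => by linear_combination R4 i m)
    (fun i m => R2 i m)
    (fun i m => by
      linear_combination (q * t * c m) * R2' i m - R3' i m
        - t * (β i - 1) * ψ t (c m) (β (i + 1)) * hcs m)
    (fun i m => by
      linear_combination - R3' i m
        + (t * ψ t (c m) (β i) - t * β i * ψ (q * t) (c m) (β i)) * hcs m)
  have A : ∀ (T : ℂ) (k : ℕ), tauS q ψ N (-1) (k : ℤ) T b1 b3
      = e * TT N (fun i m => ψ T (c m) (β (i + k))) := by
    intro T k
    rw [tauS, he]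
    congr 2
    ext i m
    simp only [hc, hβ, ← mul_assoc, ← zpow_add₀ hq]
    rw [show (m : ℤ) + 1 - N + -1 = (m : ℤ) - N by push_cast; ring,
      show ((i + k : ℕ) : ℤ) = (i : ℤ) + k by push_cast; ring]
  have B : ∀ (T : ℂ) (k : ℕ), tauS q ψ (N + 1) 0 (k : ℤ) T b1 b3
      = e' * TT (N + 1) (fun i m => ψ T (c m) (β (i + k))) := by
    intro T k
    rw [tauS, he']
    congr 2
    ext i m
    simp only [hc, hβ, ← mul_assoc, ← zpow_add₀ hq]
    rw [show (m : ℤ) + 1 - ((N + 1 : ℕ) : ℤ) + 0 = (m : ℤ) - N by push_cast; ring,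
      show ((i + k : ℕ) : ℤ) = (i : ℤ) + k by push_cast; ring]
  have A1 := A t 1
  have A2 := A t 2
  have A3 := A (q * t) 1
  have B1 := B t 1
  have B0 := B t 0
  have B3 := B (t / q) 1
  simp only [Nat.cast_one, Nat.cast_zero, Nat.cast_ofNat, add_zero] at A1 A2 A3 B1 B0 B3
  rw [A1, A2, A3, B1, B0, B3]
  have hx0 : q ^ (-(N : ℤ)) * t * b1 = t * c 0 := by
    simp only [hc]
    rw [show ((0 : ℕ) : ℤ) - (N : ℤ) = -(N : ℤ) by simp]
    ring
  rw [hx0]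
  linear_combination (e * e') * key
end
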